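/- arXiv:1107.4906 — 2 statements merged into one kernel-verified Lean document; each statement's English description precedes it below -/
import Mathlib

section
/- For 7 general points of P^1 x P^1, the ideal I of the points satisfies γ(I) = 56/15; that is, there is a nonempty Zariski-open subset U of (P^1 x P^1)^7 such that for every 7-tuple of pairwise distinct points lying in U, with I the ideal of these points, α(I^(m))/m tends to 56/15 as m → ∞. -/
open MvPolynomial

noncomputable section

/-- The weights giving the bigrading on `k[x0,x1,y0,y1]` with
`deg x0 = deg x1 = (1,0)` and `deg y0 = deg y1 = (0,1)`. -/
def w4 : Fin 4 → ℕ × ℕ := ![(1,0), (1,0), (0,1), (0,1)]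

variable (k : Type*) [Field k]

/-- `p = ((a0,a1),(b0,b1))` represents a point `[a0:a1] × [b0:b1]` of `P^1 × P^1`
if neither pair of coordinates is identically zero. -/
def IsPtRep (p : (k × k) × (k × k)) : Prop := p.1 ≠ 0 ∧ p.2 ≠ 0

/-- Two (nonzero) vectors of `k²` define the same point of `P^1`. -/
def ProjEq (u v : k × k) : Prop := u.1 * v.2 = u.2 * v.1

/-- Two representatives define the same point of `P^1 × P^1`. -/
def PtEq (p q : (k × k) × (k × k)) : Prop := ProjEq k p.1 q.1 ∧ ProjEq k p.2 q.2

/-- The bihomogeneous ideal of the point `[a0:a1] × [b0:b1]`, namely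
`(a1*x0 - a0*x1, b1*y0 - b0*y1)`. -/
def pointIdeal (p : (k × k) × (k × k)) : Ideal (MvPolynomial (Fin 4) k) :=
  Ideal.span {C p.1.2 * X 0 - C p.1.1 * X 1, C p.2.2 * X 2 - C p.2.1 * X 3}

/-- The ideal `I(Z) = ∩ I(P_i)` of a finite tuple of points. -/
def idealOfPoints {s : ℕ} (Z : Fin s → (k × k) × (k × k)) :
    Ideal (MvPolynomial (Fin 4) k) :=
  ⨅ i, pointIdeal k (Z i)

/-- The `m`-th symbolic power `I(Z)^(m) = ∩ I(P_i)^m`. -/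
def symbolicPower {s : ℕ} (Z : Fin s → (k × k) × (k × k)) (m : ℕ) :
    Ideal (MvPolynomial (Fin 4) k) :=
  ⨅ i, (pointIdeal k (Z i)) ^ m

/-- The bigraded piece `J_(i,j)` of a bihomogeneous ideal, as a `k`-subspace. -/
def bipiece (J : Ideal (MvPolynomial (Fin 4) k)) (d : ℕ × ℕ) :
    Submodule k (MvPolynomial (Fin 4) k) :=
  (Submodule.restrictScalars k J) ⊓ (weightedHomogeneousSubmodule k w4 d)

/-- `α(J)`: the least total degree `t = i + j` in which `J` has a nonzero
bihomogeneous element of bidegree `(i,j)`. -/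
def alpha (J : Ideal (MvPolynomial (Fin 4) k)) : ℕ :=
  sInf {t | ∃ F ∈ J, F ≠ 0 ∧ ∃ d : ℕ × ℕ, d.1 + d.2 = t ∧ F.IsWeightedHomogeneous w4 d}

/-- The coordinates of a tuple of points of `P^1 × P^1`, as a point of affine `4s`-space. -/
def coordsOf {s : ℕ} (Z : Fin s → (k × k) × (k × k)) : Fin s × Fin 4 → k :=
  fun p => ![(Z p.1).1.1, (Z p.1).1.2, (Z p.1).2.1, (Z p.1).2.2] p.2

/-- The weights making `k[(P^1 × P^1)^s]` multigraded. -/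
def wProd (s : ℕ) : Fin s × Fin 4 → (Fin s → ℕ × ℕ) := fun p => Pi.single p.1 (w4 p.2)

/-- `GeneralPosition k s P` says that property `P` holds for `s` general points of
`P^1 × P^1`: there is a nonempty Zariski-open subset `U` of `(P^1 × P^1)^s` (the
complement of the zero locus of a multihomogeneous form `G` not vanishing identically)
such that `P` holds for every tuple of pairwise distinct points lying in `U`. -/
def GeneralPosition (s : ℕ) (P : (Fin s → (k × k) × (k × k)) → Prop) : Prop :=
  ∃ (G : MvPolynomial (Fin s × Fin 4) k) (d : Fin s → ℕ × ℕ),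
    G.IsWeightedHomogeneous (wProd s) d ∧
    (∃ Z : Fin s → (k × k) × (k × k), (∀ i, IsPtRep k (Z i)) ∧ eval (coordsOf k Z) G ≠ 0) ∧
    ∀ Z : Fin s → (k × k) × (k × k), (∀ i, IsPtRep k (Z i)) →
      (∀ i j, i ≠ j → ¬ PtEq k (Z i) (Z j)) →
      eval (coordsOf k Z) G ≠ 0 → P Z

/-- Distinct points in multiplicity 1 generic position: every subset `S` imposes
independent conditions in every bidegree, i.e.
`dim_k I(S)_(i,j) = max {0, (i+1)(j+1) - |S|}`. -/
def Mult1Generic {s : ℕ} (Z : Fin s → (k × k) × (k × k)) : Prop :=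
  (∀ i, IsPtRep k (Z i)) ∧ (∀ i j, i ≠ j → ¬ PtEq k (Z i) (Z j)) ∧
  ∀ (S : Finset (Fin s)) (i j : ℕ),
    Module.finrank k ↥(bipiece k (⨅ a ∈ S, pointIdeal k (Z a)) (i, j))
      = (i + 1) * (j + 1) - S.card

namespace Cremona

section General

/-- Determinant pairing of two vectors. -/
def dt {S : Type*} [CommRing S] (u v : S × S) : S := u.1 * v.2 - u.2 * v.1

/-- The linear-in-`X` involution matrix attached to the points `p`, `q`. -/
def Am {S : Type*} [CommRing S] (p q : (S × S) × (S × S)) (X Y : S × S) : S × S :=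
  (p.1.2 * q.2.2 ^ 2 * dt q.1 X * dt p.2 Y) • p.2 + (q.1.2 * p.2.2 ^ 2 * dt p.1 X * dt q.2 Y) • q.2

/-- Embedding of vectors along an algebra map. -/
def em {K S T : Type*} [FunLike T K S] (f : T) (u : K × K) : S × S := (f u.1, f u.2)

/-- Embedding of points. -/
def emp {K S T : Type*} [FunLike T K S] (f : T) (p : (K × K) × (K × K)) : (S × S) × (S × S) :=
  (em f p.1, em f p.2)

/-- Evaluation of a form. -/
def ev {K S : Type*} [Field K] [CommRing S] [Algebra K S] (F : MvPolynomial (Fin 4) K)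
    (X Y : S × S) : S := aeval ![X.1, X.2, Y.1, Y.2] F

variable {K : Type*} [Field K]

lemma map_ev {S T : Type*} [CommRing S] [Algebra K S] [CommRing T] [Algebra K T]
    (f : S →ₐ[K] T) (F : MvPolynomial (Fin 4) K) (X Y : S × S) :
    f (ev F X Y) = ev F (em f X) (em f Y) := by
  unfold ev
  rw [← AlgHom.comp_apply, comp_aeval]
  congr 2
  funext i
  fin_cases i <;> simp [em]

lemma weight_w4 (d : Fin 4 →₀ ℕ) : Finsupp.weight w4 d = (d 0 + d 1, d 2 + d 3) := by
  rw [Finsupp.weight_apply, Finsupp.sum_fintype _ _ (by simp)]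
  ext <;> simp [Fin.sum_univ_four, w4]

lemma ev_hom {S : Type*} [CommRing S] [Algebra K S] {F : MvPolynomial (Fin 4) K} {a b : ℕ}
    (hF : F.IsWeightedHomogeneous w4 (a, b)) (s r : S) (X Y : S × S) :
    ev F (s • X) (r • Y) = s ^ a * r ^ b * ev F X Y := by
  unfold ev
  rw [aeval_def, aeval_def, eval₂_eq', eval₂_eq', Finset.mul_sum]
  refine Finset.sum_congr rfl fun d hd => ?_
  have h := hF (mem_support_iff.mp hd)
  rw [weight_w4] at h
  simp only [Prod.mk.injEq] at h
  obtain ⟨h1, h2⟩ := h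
  simp only [Fin.prod_univ_four, ← h1, ← h2]
  simp
  ring

lemma hom_of_mul {P F : MvPolynomial (Fin 4) K} {d D : ℕ × ℕ} (hP : P.IsWeightedHomogeneous w4 d)
    (hP0 : P ≠ 0) (hF0 : F ≠ 0) (h : (P * F).IsWeightedHomogeneous w4 D) :
    ∃ e, d + e = D ∧ F.IsWeightedHomogeneous w4 e := by
  classical
  letI := weightedGradedAlgebra K w4
  have key : ∀ e, weightedHomogeneousComponent w4 e F ≠ 0 → d + e = D := by
    intro e he
    have h1 := DirectSum.coe_decompose_mul_add_of_left_mem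
      (weightedHomogeneousSubmodule K w4) (i := d) (j := e) (a := P) (b := F) hP
    rw [← decompose'_apply] at he
    by_contra hne
    have h2 : ((DirectSum.decompose (weightedHomogeneousSubmodule K w4) (P * F)) (d + e) :
        MvPolynomial (Fin 4) K) = 0 :=
      DirectSum.decompose_of_mem_ne _ h (Ne.symm hne)
    rw [h2] at h1
    exact (mul_ne_zero hP0 he) h1.symm
  have hex : ∃ e, weightedHomogeneousComponent w4 e F ≠ 0 := by
    by_contra hcon
    push Not at hcon
    apply hF0
    ext x
    have := congrArg (coeff x) (hcon (Finsupp.weight w4 x))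
    rw [coeff_weightedHomogeneousComponent] at this
    simpa using this
  obtain ⟨e, he⟩ := hex
  refine ⟨e, key e he, ?_⟩
  intro x hx
  have : weightedHomogeneousComponent w4 (Finsupp.weight w4 x) F ≠ 0 := by
    intro h0
    have := congrArg (coeff x) h0
    rw [coeff_weightedHomogeneousComponent] at this
    simp at this
    exact hx this
  have h3 := key _ this
  have h4 := key _ he
  exact add_left_cancel (h3.trans h4.symm)

/-- the generic vectors -/
def gX : MvPolynomial (Fin 4) K × MvPolynomial (Fin 4) K := (X 0, X 1)
def gY : MvPolynomial (Fin 4) K × MvPolynomial (Fin 4) K := (X 2, X 3)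

lemma ev_gen (F : MvPolynomial (Fin 4) K) : ev F gX gY = F := by
  unfold ev gX gY
  conv_rhs => rw [← aeval_X_left_apply F]
  congr 2
  funext i
  fin_cases i <;> simp

/-- The linear form `det(x, X)`. -/
def lf (x : K × K) : MvPolynomial (Fin 4) K := dt (em C x) gX

lemma lf_hom (x : K × K) : (lf x).IsWeightedHomogeneous w4 (1, 0) := by
  unfold lf dt em gX
  refine IsWeightedHomogeneous.sub ?_ ?_
  · simpa [w4] using (isWeightedHomogeneous_X K w4 (1 : Fin 4)).C_mul x.1
  · simpa [w4] using (isWeightedHomogeneous_X K w4 (0 : Fin 4)).C_mul x.2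

lemma ev_lf {S : Type*} [CommRing S] [Algebra K S] (x : K × K) (X Y : S × S) :
    ev (lf x) X Y = dt (em (algebraMap K S) x) X := by
  simp [ev, lf, dt, em, gX]

lemma em_algHom {S T : Type*} [CommRing S] [Algebra K S] [CommRing T] [Algebra K T]
    (f : S →ₐ[K] T) (x : K × K) : em f (em (algebraMap K S) x) = em (algebraMap K T) x := by
  simp [em]

lemma dt_em {S : Type*} [CommRing S] [Algebra K S] (x y : K × K) :
    dt (em (algebraMap K S) x) (em (algebraMap K S) y) = algebraMap K S (dt x y) := by
  simp [em, dt]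

lemma lf_ne_zero {x y : K × K} (h : dt x y ≠ 0) : lf x ≠ 0 := by
  intro h0
  have := ev_lf x y (0 : K × K)
  rw [h0] at this
  simp [ev, em, dt] at this h
  exact h this.symm

lemma lf_prime {x y : K × K} (h : dt x y ≠ 0) : Prime (lf x) := by
  obtain ⟨c, hc⟩ : ∃ c, c * dt x y = 1 := ⟨_, inv_mul_cancel₀ h⟩
  let f : MvPolynomial (Fin 4) K →ₐ[K] MvPolynomial (Fin 4) K := aeval ![lf x, lf y, X 2, X 3]
  let g : MvPolynomial (Fin 4) K →ₐ[K] MvPolynomial (Fin 4) K :=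
    aeval ![C c * (C y.1 * X 0 - C x.1 * X 1),
      C c * (C y.2 * X 0 - C x.2 * X 1), X 2, X 3]
  have hd' : C (σ := Fin 4) c * (C x.1 * C y.2 - C x.2 * C y.1) = 1 := by
    have := congrArg (C (σ := Fin 4)) hc
    simpa [dt] using this
  have hfg : f.comp g = AlgHom.id K _ := by
    ext i : 1
    fin_cases i
    · simp [f, g, lf, gX, dt, em]
      linear_combination (X 0 : MvPolynomial (Fin 4) K) * hd'
    · simp [f, g, lf, gX, dt, em]
      linear_combination (X 1 : MvPolynomial (Fin 4) K) * hd'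
    · simp [f, g]
    · simp [f, g]
  have hgf : g.comp f = AlgHom.id K _ := by
    ext i : 1
    fin_cases i
    · simp [f, g, lf, gX, dt, em]
      linear_combination (X 0 : MvPolynomial (Fin 4) K) * hd'
    · simp [f, g, lf, gX, dt, em]
      linear_combination (X 1 : MvPolynomial (Fin 4) K) * hd'
    · simp [f, g]
    · simp [f, g]
  let E : MvPolynomial (Fin 4) K ≃ₐ[K] MvPolynomial (Fin 4) K := AlgEquiv.ofAlgHom f g hfg hgf
  have hE : E (X 0) = lf x := by simp [E, f]
  rw [← hE, MulEquiv.prime_iff]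
  exact X_prime

/-- The generic ring used to define multiplicities. -/
abbrev QQ (K : Type*) [Field K] := MvPolynomial (Fin 7) K

/-- The form `F` vanishes to order at least `m` at the point `p`. -/
def Mult (p : (K × K) × (K × K)) (m : ℤ) (F : MvPolynomial (Fin 4) K) : Prop :=
  (X 0 : QQ K) ^ m.toNat ∣
    ev F ((X 1 : QQ K) • em (algebraMap K (QQ K)) p.1 + (X 0 : QQ K) • ((X 3 : QQ K), (X 4 : QQ K)))
      ((X 2 : QQ K) • em (algebraMap K (QQ K)) p.2 + (X 0 : QQ K) • ((X 5 : QQ K), (X 6 : QQ K)))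

lemma Mult.spec {p : (K × K) × (K × K)} {m : ℤ} {F : MvPolynomial (Fin 4) K} (h : Mult p m F)
    {S : Type*} [CommRing S] [Algebra K S] (t l u : S) (U V : S × S) :
    t ^ m.toNat ∣ ev F (l • em (algebraMap K S) p.1 + t • U) (u • em (algebraMap K S) p.2 + t • V) := by
  obtain ⟨U0, U1⟩ := U
  obtain ⟨V0, V1⟩ := V
  have h1 := map_dvd (aeval ![t, l, u, U0, U1, V0, V1] : QQ K →ₐ[K] S) h
  rw [map_ev] at h1
  simpa [em, aeval_X] using h1

/-- there is a nonzero form of class `(a, b; m)` for the configuration `Z`. -/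
def Good (Z : Fin 7 → (K × K) × (K × K)) (a b : ℤ) (m : Fin 7 → ℤ) : Prop :=
  ∃ (F : MvPolynomial (Fin 4) K) (a' b' : ℕ), (a' : ℤ) = a ∧ (b' : ℤ) = b ∧ F ≠ 0 ∧
    F.IsWeightedHomogeneous w4 (a', b') ∧ ∀ l, Mult (Z l) (m l) F

/-- Elementary transformation of configurations. -/
def Ph {S : Type*} [CommRing S] (i j : Fin 7) (Z : Fin 7 → (S × S) × (S × S)) :
    Fin 7 → (S × S) × (S × S) :=
  fun l => if l = i ∨ l = j then Z l else ((Z l).1, Am (Z i) (Z j) (Z l).1 (Z l).2)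

/-- nondegeneracy condition for the elementary transformation. -/
structure ND (i j : Fin 7) (Z : Fin 7 → (K × K) × (K × K)) : Prop where
  x : dt (Z i).1 (Z j).1 ≠ 0
  y : dt (Z i).2 (Z j).2 ≠ 0
  xi : ∀ l, l ≠ i → dt (Z i).1 (Z l).1 ≠ 0
  xj : ∀ l, l ≠ j → dt (Z j).1 (Z l).1 ≠ 0
  ai : (Z i).1.2 ≠ 0
  aj : (Z j).1.2 ≠ 0
  bi : (Z i).2.2 ≠ 0
  bj : (Z j).2.2 ≠ 0

/-- The scalar by which the square of the matrix acts. -/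
def kap {S : Type*} [CommRing S] (p q : (S × S) × (S × S)) (X : S × S) : S :=
  - (p.1.2 * q.2.2 ^ 2 * (q.1.2 * p.2.2 ^ 2) * dt p.1 X * dt q.1 X * dt p.2 q.2 ^ 2)

lemma Am_Am {S : Type*} [CommRing S] (p q : (S × S) × (S × S)) (X Y : S × S) :
    Am p q X (Am p q X Y) = kap p q X • Y := by
  ext <;> simp [Am, kap, dt] <;> ring

lemma Am_lin {S : Type*} [CommRing S] (p q : (S × S) × (S × S)) (l t u : S) (X U Y V : S × S) :
    Am p q (l • X + t • U) (u • Am p q X Y + t • V) = (l * u * kap p q X) • Y +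
      t • (u • Am p q U (Am p q X Y) + Am p q (l • X + t • U) V) := by
  ext <;> simp [Am, kap, dt] <;> ring

lemma Am_p {S : Type*} [CommRing S] (p q : (S × S) × (S × S)) (l t u : S) (U V : S × S) :
    Am p q (l • p.1 + t • U) (u • p.2 + t • V) =
      t • ((p.1.2 * q.2.2 ^ 2 * dt q.1 (l • p.1 + t • U) * dt p.2 V) • p.2 +
       (q.1.2 * p.2.2 ^ 2 * dt p.1 U * dt q.2 (u • p.2 + t • V)) • q.2) := by
  ext <;> simp [Am, dt] <;> ring

lemma Am_comm {S : Type*} [CommRing S] (p q : (S × S) × (S × S)) (X Y : S × S) :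
    Am p q X Y = Am q p X Y := by
  ext <;> simp [Am] <;> ring

lemma Am_smul {S : Type*} [CommRing S] (p q : (S × S) × (S × S)) (s r : S) (X Y : S × S) :
    Am p q (s • X) (r • Y) = (s * r) • Am p q X Y := by
  ext <;> simp [Am, dt] <;> ring

lemma map_Am {S T G : Type*} [CommRing S] [CommRing T] [FunLike G S T] [RingHomClass G S T] (f : G)
    (p q : (S × S) × (S × S)) (X Y : S × S) :
    em f (Am p q X Y) = Am (emp f p) (emp f q) (em f X) (em f Y) := by
  simp [em, emp, Am, dt]

/-- Substitution homomorphism. -/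
def sig (p q : (K × K) × (K × K)) (F : MvPolynomial (Fin 4) K) : MvPolynomial (Fin 4) K :=
  ev F gX (Am (emp C p) (emp C q) gX gY)

lemma em_gX {S : Type*} [CommRing S] [Algebra K S] (X Y : S × S) :
    em (aeval ![X.1, X.2, Y.1, Y.2] : MvPolynomial (Fin 4) K →ₐ[K] S) gX = X := by
  simp [em, gX]

lemma em_gY {S : Type*} [CommRing S] [Algebra K S] (X Y : S × S) :
    em (aeval ![X.1, X.2, Y.1, Y.2] : MvPolynomial (Fin 4) K →ₐ[K] S) gY = Y := by
  simp [em, gY]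

lemma ev_sig {S : Type*} [CommRing S] [Algebra K S] (p q : (K × K) × (K × K))
    (F : MvPolynomial (Fin 4) K) (X Y : S × S) :
    ev (sig p q F) X Y =
      ev F X (Am (emp (algebraMap K S) p) (emp (algebraMap K S) q) X Y) := by
  have h : ev (sig p q F) X Y = (aeval ![X.1, X.2, Y.1, Y.2] : MvPolynomial (Fin 4) K →ₐ[K] S)
    (sig p q F) := rfl
  rw [h, sig, map_ev, map_Am, em_gX, em_gY]
  congr 2 <;> simp [emp, em]

lemma sig_comm (p q : (K × K) × (K × K)) (F : MvPolynomial (Fin 4) K) : sig p q F = sig q p F := by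
  unfold sig; rw [Am_comm]

lemma ev_mul {S : Type*} [CommRing S] [Algebra K S] (F G : MvPolynomial (Fin 4) K) (X Y : S × S) :
    ev (F * G) X Y = ev F X Y * ev G X Y := by simp [ev]

lemma ev_pow {S : Type*} [CommRing S] [Algebra K S] (F : MvPolynomial (Fin 4) K) (n : ℕ) (X Y : S × S) :
    ev (F ^ n) X Y = ev F X Y ^ n := by simp [ev]

lemma sig_ne_zero {p q : (K × K) × (K × K)} {F : MvPolynomial (Fin 4) K} {a b : ℕ}
    (hF : F.IsWeightedHomogeneous w4 (a, b)) (h0 : F ≠ 0)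
    (hx : dt p.1 q.1 ≠ 0) (hy : dt p.2 q.2 ≠ 0) (h1 : p.1.2 ≠ 0) (h2 : q.1.2 ≠ 0)
    (h3 : p.2.2 ≠ 0) (h4 : q.2.2 ≠ 0) : sig p q F ≠ 0 := by
  intro hs
  have h := ev_sig p q F gX (Am (emp (algebraMap K (MvPolynomial (Fin 4) K)) p)
    (emp (algebraMap K (MvPolynomial (Fin 4) K)) q) gX gY)
  rw [hs, Am_Am] at h
  have h5 := ev_hom hF 1 (kap (emp (algebraMap K (MvPolynomial (Fin 4) K)) p)
    (emp (algebraMap K (MvPolynomial (Fin 4) K)) q) gX) gX gY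
  rw [one_smul, ← h, ev_gen, one_pow, one_mul] at h5
  have h6 : ev (0 : MvPolynomial (Fin 4) K) gX (Am (emp (algebraMap K (MvPolynomial (Fin 4) K)) p)
    (emp (algebraMap K (MvPolynomial (Fin 4) K)) q) gX gY) = 0 := by simp [ev]
  rw [h6] at h5
  refine mul_ne_zero (pow_ne_zero _ ?_) h0 h5.symm
  have hx' : dt q.1 p.1 ≠ 0 := by
    intro h; apply hx; simp only [dt] at h ⊢; linear_combination -h
  have e1 := lf_ne_zero hx
  have e2 := lf_ne_zero hx'
  have e3 : C (σ := Fin 4) (dt p.2 q.2) ≠ 0 := by simpa using hy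
  have hk : kap (emp (algebraMap K (MvPolynomial (Fin 4) K)) p)
    (emp (algebraMap K (MvPolynomial (Fin 4) K)) q) gX =
    -(C p.1.2 * C q.2.2 ^ 2 * (C q.1.2 * C p.2.2 ^ 2) * lf p.1 * lf q.1 * C (dt p.2 q.2) ^ 2) := by
    simp [kap, emp, em, lf, dt, algebraMap_eq]
  rw [hk]
  have c1 : C (σ := Fin 4) p.1.2 ≠ 0 := by simpa using h1
  have c2 : C (σ := Fin 4) q.1.2 ≠ 0 := by simpa using h2
  have c3 : C (σ := Fin 4) p.2.2 ≠ 0 := by simpa using h3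
  have c4 : C (σ := Fin 4) q.2.2 ≠ 0 := by simpa using h4
  refine neg_ne_zero.mpr ?_
  refine mul_ne_zero (mul_ne_zero (mul_ne_zero (mul_ne_zero ?_ ?_) e1) e2) (pow_ne_zero _ e3)
  · exact mul_ne_zero c1 (pow_ne_zero _ c4)
  · exact mul_ne_zero c2 (pow_ne_zero _ c3)

lemma dvd_sig {p q : (K × K) × (K × K)} {F : MvPolynomial (Fin 4) K} {m : ℤ}
    (hF : Mult p m F) (hx : dt p.1 q.1 ≠ 0) : lf p.1 ^ m.toNat ∣ sig p q F := by
  obtain ⟨c, hc⟩ : ∃ c, c * dt p.1 q.1 = 1 := ⟨_, inv_mul_cancel₀ hx⟩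
  have hd' : C (σ := Fin 4) c * (C p.1.1 * C q.1.2 - C p.1.2 * C q.1.1) = 1 := by
    have := congrArg (C (σ := Fin 4)) hc
    simpa [dt] using this
  have h := hF.spec (S := MvPolynomial (Fin 4) K) (lf p.1) (- C c * lf q.1)
    (C p.1.2 * C q.2.2 ^ 2 * lf q.1 * dt (em C p.2) gY)
    ((C c : MvPolynomial (Fin 4) K) • em C q.1) ((C q.1.2 * C p.2.2 ^ 2 * dt (em C q.2) gY) • em C q.2)
  convert h using 1
  unfold sig
  congr 1
  · ext1
    · simp [gX, em, lf, dt, algebraMap_eq]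
      linear_combination - (X 0 : MvPolynomial (Fin 4) K) * hd'
    · simp [gX, em, lf, dt, algebraMap_eq]
      linear_combination - (X 1 : MvPolynomial (Fin 4) K) * hd'
  · ext1 <;> simp [Am, emp, em, lf, dt, algebraMap_eq] <;> ring

lemma hom_sig {p q : (K × K) × (K × K)} {F : MvPolynomial (Fin 4) K} {a b : ℕ}
    (hF : F.IsWeightedHomogeneous w4 (a, b)) : (sig p q F).IsWeightedHomogeneous w4 (a + b, b) := by
  have hX : ∀ i : Fin 4, (X i : MvPolynomial (Fin 4) K).IsWeightedHomogeneous w4 (w4 i) :=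
    fun i => isWeightedHomogeneous_X K w4 i
  have hdy : ∀ v : K × K, (dt (em C v) gY : MvPolynomial (Fin 4) K).IsWeightedHomogeneous w4 (0, 1) := by
    intro v
    unfold dt em gY
    refine IsWeightedHomogeneous.sub ?_ ?_
    · simpa [w4] using (hX 3).C_mul v.1
    · simpa [w4] using (hX 2).C_mul v.2
  have term : ∀ (c d e : K) (x v : K × K), (C c * C d ^ 2 * dt (em C x) gX * dt (em C v) gY * C e :
      MvPolynomial (Fin 4) K).IsWeightedHomogeneous w4 (1, 1) := by
    intro c d e x v
    have := (((lf_hom x).mul (hdy v)).C_mul (c * d ^ 2 * e))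
    convert this using 1
    · simp [lf]; ring
    · simp
  have h1 : (Am (emp C p) (emp C q) gX gY : _ × MvPolynomial (Fin 4) K).1.IsWeightedHomogeneous
      w4 (1, 1) := (term _ _ _ _ _).add (term _ _ _ _ _)
  have h2 : (Am (emp C p) (emp C q) gX gY : _ × MvPolynomial (Fin 4) K).2.IsWeightedHomogeneous
      w4 (1, 1) := (term _ _ _ _ _).add (term _ _ _ _ _)
  unfold sig ev
  rw [aeval_def, eval₂_eq']
  refine IsWeightedHomogeneous.sum _ _ _ fun d hd => ?_
  have h := hF (mem_support_iff.mp hd)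
  rw [weight_w4] at h
  simp only [Prod.mk.injEq] at h
  obtain ⟨ha, hb⟩ := h
  refine IsWeightedHomogeneous.C_mul ?_ _
  simp only [Fin.prod_univ_four]
  have := ((((hX 0).pow (d 0)).mul ((hX 1).pow (d 1))).mul (h1.pow (d 2))).mul (h2.pow (d 3))
  convert this using 1
  · rfl
  · ext
    · simp [w4]; omega
    · simp [w4]; omega

lemma not_X0_dvd (P : QQ K) (v : Fin 7 → K) (hv : v 0 = 0) (h : aeval v P ≠ 0) :
    ¬ (X 0 : QQ K) ∣ P := by
  rintro ⟨R, rfl⟩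
  apply h
  simp [hv]

lemma mult_other {p q z : (K × K) × (K × K)} {F F' : MvPolynomial (Fin 4) K} {m : ℤ}
    {c1 c2 d1 d2 : ℕ}
    (hF : Mult z m F)
    (hF' : lf p.1 ^ c1 * lf q.1 ^ c2 * F' = lf p.1 ^ d1 * lf q.1 ^ d2 * sig p q F)
    (hp : dt p.1 z.1 ≠ 0) (hq : dt q.1 z.1 ≠ 0) :
    Mult (z.1, Am p q z.1 z.2) m F' := by
  unfold Mult
  set XX := (X 1 : QQ K) • em (algebraMap K (QQ K)) z.1 +
    (X 0 : QQ K) • ((X 3 : QQ K), (X 4 : QQ K)) with hXX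
  set YY := (X 2 : QQ K) • em (algebraMap K (QQ K)) (Am p q z.1 z.2) +
    (X 0 : QQ K) • ((X 5 : QQ K), (X 6 : QQ K)) with hYY
  have h1 := congrArg (fun P => ev P XX YY) hF'
  simp only [ev_mul, ev_pow, ev_lf, ev_sig] at h1
  have h2 := Am_lin (emp (algebraMap K (QQ K)) p) (emp (algebraMap K (QQ K)) q) (X 1) (X 0) (X 2)
    (em (algebraMap K (QQ K)) z.1) ((X 3 : QQ K), (X 4 : QQ K)) (em (algebraMap K (QQ K)) z.2)
    ((X 5 : QQ K), (X 6 : QQ K))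
  rw [← map_Am, ← hXX, ← hYY] at h2
  rw [h2] at h1
  have h3 : (X 0 : QQ K) ^ m.toNat ∣ (dt (em (algebraMap K (QQ K)) p.1) XX ^ c1 *
      dt (em (algebraMap K (QQ K)) q.1) XX ^ c2) * ev F' XX YY := by
    rw [h1]
    exact Dvd.dvd.mul_left (hF.spec _ _ _ _ _) _
  refine X_prime.pow_dvd_of_dvd_mul_left _ ?_ h3
  refine not_X0_dvd _ ![0, 1, 0, 0, 0, 0, 0] rfl ?_
  simp [hXX, em, dt, sub_eq_zero] at hp hq ⊢
  exact ⟨fun h => absurd h hp, fun h => absurd h hq⟩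

lemma mult_self {p q : (K × K) × (K × K)} {F F' : MvPolynomial (Fin 4) K} {m : ℤ}
    {a b c1 c2 d1 d2 : ℕ}
    (hF : F.IsWeightedHomogeneous w4 (a, b))
    (hF' : lf p.1 ^ c1 * lf q.1 ^ c2 * F' = lf p.1 ^ d1 * lf q.1 ^ d2 * sig p q F)
    (hm : (c1 : ℤ) - d1 = m) (hp : dt p.1 q.1 ≠ 0) :
    Mult p (b - m) F' := by
  unfold Mult
  by_cases hneg : (b : ℤ) - m ≤ 0
  · rw [Int.toNat_of_nonpos hneg]; simp
  have hle : c1 ≤ d1 + b := by omega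
  have hn : ((b : ℤ) - m).toNat = d1 + b - c1 := by omega
  rw [hn]
  set XX := (X 1 : QQ K) • em (algebraMap K (QQ K)) p.1 +
    (X 0 : QQ K) • ((X 3 : QQ K), (X 4 : QQ K)) with hXX
  set YY := (X 2 : QQ K) • em (algebraMap K (QQ K)) p.2 +
    (X 0 : QQ K) • ((X 5 : QQ K), (X 6 : QQ K)) with hYY
  have h1 := congrArg (fun P => ev P XX YY) hF'
  simp only [ev_mul, ev_pow, ev_lf, ev_sig] at h1
  have h2 := Am_p (emp (algebraMap K (QQ K)) p) (emp (algebraMap K (QQ K)) q) (X 1) (X 0) (X 2)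
    ((X 3 : QQ K), (X 4 : QQ K)) ((X 5 : QQ K), (X 6 : QQ K))
  change Am _ _ XX YY = _ at h2
  have h3 : ∀ W, ev F XX ((X 0 : QQ K) • W) = (X 0 : QQ K) ^ b * ev F XX W := by
    intro W
    have := ev_hom hF (1 : QQ K) (X 0) XX W
    simpa using this
  rw [h2, h3] at h1
  have h4 : dt (em (algebraMap K (QQ K)) p.1) XX =
      X 0 * dt (em (algebraMap K (QQ K)) p.1) ((X 3 : QQ K), (X 4 : QQ K)) := by
    simp [hXX, dt, em]; ring
  rw [h4] at h1
  set L := dt (em (algebraMap K (QQ K)) p.1) ((X 3 : QQ K), (X 4 : QQ K)) with hL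
  set M := dt (em (algebraMap K (QQ K)) q.1) XX with hM
  have h5 : (X 0 : QQ K) ^ (d1 + b - c1) ∣ (L ^ c1 * M ^ c2) * ev F' XX YY := by
    have h6 : (X 0 : QQ K) ^ c1 * X 0 ^ (d1 + b - c1) ∣
        X 0 ^ c1 * ((L ^ c1 * M ^ c2) * ev F' XX YY) := by
      rw [← pow_add, Nat.add_sub_cancel' hle]
      have : X 0 ^ c1 * ((L ^ c1 * M ^ c2) * ev F' XX YY) = (X 0 * L) ^ c1 * M ^ c2 * ev F' XX YY := by
        ring
      rw [this, h1]
      generalize ev F XX _ = E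
      exact ⟨L ^ d1 * M ^ d2 * E, by rw [mul_pow, pow_add]; ring⟩
    exact (mul_dvd_mul_iff_left (pow_ne_zero _ (X_ne_zero 0))).mp h6
  refine X_prime.pow_dvd_of_dvd_mul_left _ ?_ h5
  refine not_X0_dvd _ ![0, 1, 0, q.1.1, q.1.2, 0, 0] rfl ?_
  simp [hL, hM, hXX, em, dt, sub_eq_zero] at hp ⊢
  exact ⟨fun h => absurd h hp, fun h => absurd (by linear_combination -h) hp⟩

lemma good_step {i j : Fin 7} (hij : i ≠ j) {Z : Fin 7 → (K × K) × (K × K)} (hZ : ND i j Z)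
    {a b : ℤ} {m : Fin 7 → ℤ} (h : Good Z a b m) :
    Good (Ph i j Z) (a + b - m i - m j) b
      (fun l => if l = i ∨ l = j then b - m l else m l) := by
  obtain ⟨F, a', b', rfl, rfl, h0, hF, hm⟩ := h
  have hx' : dt (Z j).1 (Z i).1 ≠ 0 := hZ.xj i hij
  have D1 : lf (Z i).1 ^ (m i).toNat ∣ sig (Z i) (Z j) F := dvd_sig (hm i) hZ.x
  have D2 : lf (Z j).1 ^ (m j).toNat ∣ sig (Z i) (Z j) F := by
    rw [sig_comm]; exact dvd_sig (hm j) hx'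
  have D3 : lf (Z i).1 ^ (m i).toNat * lf (Z j).1 ^ (m j).toNat ∣ sig (Z i) (Z j) F := by
    obtain ⟨R, hR⟩ := D1
    rw [hR] at D2 ⊢
    refine mul_dvd_mul_left _ ?_
    refine (lf_prime hx').pow_dvd_of_dvd_mul_left _ ?_ D2
    intro hd
    have hd := (lf_prime hx').dvd_of_dvd_pow hd
    obtain ⟨T, hT⟩ := hd
    have := congrArg (fun P => ev P (Z j).1 (0 : K × K)) hT
    simp only [ev_mul, ev_lf] at this
    apply hZ.x
    simp [dt, em] at this ⊢
    linear_combination this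
  obtain ⟨F1, hF1⟩ := D3
  have hs : sig (Z i) (Z j) F ≠ 0 := sig_ne_zero hF h0 hZ.x hZ.y hZ.ai hZ.aj hZ.bi hZ.bj
  have hli := lf_ne_zero hZ.x
  have hlj := lf_ne_zero hx'
  have hF10 : F1 ≠ 0 := by rintro rfl; simp at hF1; exact hs hF1
  set F' := lf (Z i).1 ^ (-m i).toNat * lf (Z j).1 ^ (-m j).toNat * F1 with hF'd
  have hF'0 : F' ≠ 0 := mul_ne_zero (mul_ne_zero (pow_ne_zero _ hli) (pow_ne_zero _ hlj)) hF10
  have hF' : lf (Z i).1 ^ (m i).toNat * lf (Z j).1 ^ (m j).toNat * F' =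
      lf (Z i).1 ^ (-m i).toNat * lf (Z j).1 ^ (-m j).toNat * sig (Z i) (Z j) F := by
    rw [hF1, hF'd]; ring
  have hhom := ((((lf_hom (Z i).1).pow (-m i).toNat).mul ((lf_hom (Z j).1).pow (-m j).toNat)).mul
    (hom_sig (p := Z i) (q := Z j) hF))
  rw [← hF'] at hhom
  obtain ⟨⟨e1, e2⟩, he, hFe⟩ := hom_of_mul
    (((lf_hom (Z i).1).pow (m i).toNat).mul ((lf_hom (Z j).1).pow (m j).toNat))
    (mul_ne_zero (pow_ne_zero _ hli) (pow_ne_zero _ hlj)) hF'0 hhom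
  simp at he
  refine ⟨F', e1, e2, by omega, by omega, hF'0, hFe, ?_⟩
  intro l
  by_cases hl : l = i
  · subst hl
    simp only [Ph, true_or, if_true]
    exact mult_self hF hF' (by omega) hZ.x
  by_cases hl' : l = j
  · subst hl'
    simp only [Ph, or_true, if_true]
    refine mult_self (q := Z i) (c1 := (m l).toNat) (c2 := (m i).toNat) (d1 := (-m l).toNat)
      (d2 := (-m i).toNat) hF ?_ (by omega) hx'
    rw [sig_comm, mul_comm (lf (Z l).1 ^ _), mul_comm (lf (Z l).1 ^ _)]
    exact hF'
  · simp only [Ph, hl, hl', or_self, if_false]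
    exact mult_other (hm l) hF' (hZ.xi l hl) (hZ.xj l hl')

lemma Ph_ND {i j : Fin 7} {Z : Fin 7 → (K × K) × (K × K)} (hZ : ND i j Z) : ND i j (Ph i j Z) := by
  have hi : Ph i j Z i = Z i := by simp [Ph]
  have hj : Ph i j Z j = Z j := by simp [Ph]
  have hl : ∀ l, (Ph i j Z l).1 = (Z l).1 := by intro l; unfold Ph; split_ifs <;> rfl
  constructor <;> simp only [hi, hj, hl]
  exacts [hZ.x, hZ.y, hZ.xi, hZ.xj, hZ.ai, hZ.aj, hZ.bi, hZ.bj]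

/-- scalars for the square of the elementary transformation. -/
def scal (i j : Fin 7) (Z : Fin 7 → (K × K) × (K × K)) (l : Fin 7) : K :=
  if l = i ∨ l = j then 1 else kap (Z i) (Z j) (Z l).1

lemma scal_ne {i j : Fin 7} {Z : Fin 7 → (K × K) × (K × K)} (hZ : ND i j Z) (l : Fin 7) :
    scal i j Z l ≠ 0 := by
  unfold scal
  split_ifs with h
  · exact one_ne_zero
  · push Not at h
    unfold kap
    have := hZ.xi l h.1
    have := hZ.xj l h.2
    have := hZ.y
    have := hZ.ai
    have := hZ.aj
    have := hZ.bi
    have := hZ.bj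
    simp [*]

lemma Ph_Ph (i j : Fin 7) (Z : Fin 7 → (K × K) × (K × K)) (l : Fin 7) :
    Ph i j (Ph i j Z) l = ((Z l).1, scal i j Z l • (Z l).2) := by
  have hi : Ph i j Z i = Z i := by simp [Ph]
  have hj : Ph i j Z j = Z j := by simp [Ph]
  by_cases h : l = i ∨ l = j
  · have hl : Ph i j Z l = Z l := by simp [Ph, h]
    rw [show Ph i j (Ph i j Z) l = Ph i j Z l by simp [Ph, h], hl]
    simp [scal, h]
  · have hl : Ph i j Z l = ((Z l).1, Am (Z i) (Z j) (Z l).1 (Z l).2) := by simp [Ph, h]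
    rw [show Ph i j (Ph i j Z) l = ((Ph i j Z l).1, Am (Ph i j Z i) (Ph i j Z j) (Ph i j Z l).1
      (Ph i j Z l).2) by simp only [Ph, h, if_false], hi, hj, hl]
    simp [scal, h, Am_Am]

lemma good_scale {Z : Fin 7 → (K × K) × (K × K)} {s : Fin 7 → K} (hs : ∀ l, s l ≠ 0)
    {a b : ℤ} {m : Fin 7 → ℤ} (h : Good (fun l => ((Z l).1, s l • (Z l).2)) a b m) : Good Z a b m := by
  obtain ⟨F, a', b', ha, hb, h0, hF, hm⟩ := h
  refine ⟨F, a', b', ha, hb, h0, hF, fun l => ?_⟩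
  have h1 := (hm l).spec (S := QQ K) (X 0) (X 1) (X 2 * C (s l)⁻¹) (X 3, X 4) (X 5, X 6)
  unfold Mult
  have hc : C (σ := Fin 7) (s l)⁻¹ * C (s l) = 1 := by
    rw [← C_mul, inv_mul_cancel₀ (hs l), C_1]
  have e : (X 2 * C (s l)⁻¹ : QQ K) • em (algebraMap K (QQ K)) (s l • (Z l).2) =
      (X 2 : QQ K) • em (algebraMap K (QQ K)) (Z l).2 := by
    ext1
    · simp only [em, algebraMap_eq, Prod.smul_fst, smul_eq_mul, C_mul]
      linear_combination (X 2 * C (Z l).2.1) * hc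
    · simp only [em, algebraMap_eq, Prod.smul_snd, smul_eq_mul, C_mul]
      linear_combination (X 2 * C (Z l).2.2) * hc
  simp only [e] at h1
  exact h1

lemma good_step_iff {i j : Fin 7} (hij : i ≠ j) {Z : Fin 7 → (K × K) × (K × K)} (hZ : ND i j Z)
    {a b : ℤ} {m : Fin 7 → ℤ} :
    Good (Ph i j Z) (a + b - m i - m j) b
      (fun l => if l = i ∨ l = j then b - m l else m l) ↔ Good Z a b m := by
  refine ⟨fun h => ?_, good_step hij hZ⟩
  have h1 := good_step hij (Ph_ND hZ) h
  apply good_scale (scal_ne hZ)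
  convert h1 using 1
  · funext l; rw [Ph_Ph]
  · simp; ring
  · funext l; split_ifs <;> ring

/-- exchange of the two factors on forms -/
def swF (F : MvPolynomial (Fin 4) K) : MvPolynomial (Fin 4) K := rename ![2, 3, 0, 1] F

lemma swF_ev {S : Type*} [CommRing S] [Algebra K S] (F : MvPolynomial (Fin 4) K) (X Y : S × S) :
    ev (swF F) X Y = ev F Y X := by
  unfold ev swF
  rw [aeval_rename]
  congr 2
  funext i
  fin_cases i <;> simp

lemma swF_swF (F : MvPolynomial (Fin 4) K) : swF (swF F) = F := by
  unfold swF
  rw [rename_rename]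
  conv_rhs => rw [← rename_id_apply F]
  congr 2
  funext i
  fin_cases i <;> simp

lemma good_swap {Z : Fin 7 → (K × K) × (K × K)} {a b : ℤ} {m : Fin 7 → ℤ} (h : Good Z a b m) :
    Good (fun l => ((Z l).2, (Z l).1)) b a m := by
  obtain ⟨F, a', b', ha, hb, h0, hF, hm⟩ := h
  refine ⟨swF F, b', a', hb, ha, ?_, ?_, fun l => ?_⟩
  · intro h; apply h0; rw [← swF_swF F, h]; simp [swF]
  · intro d hd
    have hd' : d ∈ (swF F).support := mem_support_iff.mpr hd
    obtain ⟨e, rfl, he⟩ := coeff_rename_ne_zero _ _ _ hd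
    have h1 := hF he
    have hinj : Function.Injective (![2, 3, 0, 1] : Fin 4 → Fin 4) := by decide
    rw [weight_w4] at h1 ⊢
    have e2 := Finsupp.mapDomain_apply hinj e 0
    have e3 := Finsupp.mapDomain_apply hinj e 1
    have e0 := Finsupp.mapDomain_apply hinj e 2
    have e1 := Finsupp.mapDomain_apply hinj e 3
    simp at e0 e1 e2 e3 h1 ⊢
    omega
  · have h1 := (hm l).spec (S := QQ K) (X 0) (X 2) (X 1) (X 5, X 6) (X 3, X 4)
    unfold Mult
    rw [swF_ev]
    exact h1
/-- Elementary transformation followed by the exchange of the factors. -/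
def T {S : Type*} [CommRing S] (i j : Fin 7) (Z : Fin 7 → (S × S) × (S × S)) :
    Fin 7 → (S × S) × (S × S) :=
  fun l => ((Ph i j Z l).2, (Ph i j Z l).1)

/-- Effect of a step on classes. -/
def st (s : Fin 7 × Fin 7) (c : ℤ × ℤ × (Fin 7 → ℤ)) : ℤ × ℤ × (Fin 7 → ℤ) :=
  (c.2.1, c.1 + c.2.1 - c.2.2 s.1 - c.2.2 s.2,
    fun l => if l = s.1 ∨ l = s.2 then c.2.1 - c.2.2 l else c.2.2 l)

/-- `Good` for bundled classes. -/
def GoodC (Z : Fin 7 → (K × K) × (K × K)) (c : ℤ × ℤ × (Fin 7 → ℤ)) : Prop :=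
  Good Z c.1 c.2.1 c.2.2

lemma good_T {i j : Fin 7} (hij : i ≠ j) {Z : Fin 7 → (K × K) × (K × K)} (hZ : ND i j Z)
    (c : ℤ × ℤ × (Fin 7 → ℤ)) : GoodC (T i j Z) (st (i, j) c) ↔ GoodC Z c := by
  obtain ⟨a, b, m⟩ := c
  have e1 : (fun l => ((T i j Z l).2, (T i j Z l).1)) = Ph i j Z := rfl
  have e2 : (fun l => ((Ph i j Z l).2, (Ph i j Z l).1)) = T i j Z := rfl
  have h0 := good_step_iff hij hZ (a := a) (b := b) (m := m)
  unfold GoodC st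
  dsimp only
  rw [← h0]
  constructor
  · intro h
    have := good_swap h
    rw [e1] at this
    exact this
  · intro h
    have := good_swap h
    rw [e2] at this
    exact this

/-- Nondegeneracy along a chain. -/
def NDs : List (Fin 7 × Fin 7) → (Fin 7 → (K × K) × (K × K)) → Prop
  | [], _ => True
  | s :: L, Z => ND s.1 s.2 Z ∧ NDs L (T s.1 s.2 Z)

/-- Effect of a chain on configurations. -/
def run : List (Fin 7 × Fin 7) → (Fin 7 → (K × K) × (K × K)) → (Fin 7 → (K × K) × (K × K))
  | [], Z => Z
  | s :: L, Z => run L (T s.1 s.2 Z)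

/-- Effect of a chain on classes. -/
def cls : List (Fin 7 × Fin 7) → ℤ × ℤ × (Fin 7 → ℤ) → ℤ × ℤ × (Fin 7 → ℤ)
  | [], c => c
  | s :: L, c => cls L (st s c)

lemma good_run (L : List (Fin 7 × Fin 7)) (hL : ∀ s ∈ L, s.1 ≠ s.2)
    (Z : Fin 7 → (K × K) × (K × K)) (hZ : NDs L Z) (c : ℤ × ℤ × (Fin 7 → ℤ)) :
    GoodC (run L Z) (cls L c) ↔ GoodC Z c := by
  induction L generalizing Z c with
  | nil => rfl
  | cons s L ih =>
    have h1 := ih (fun t ht => hL t (List.mem_cons_of_mem _ ht)) _ hZ.2 (st s c)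
    have h2 := good_T (hL s List.mem_cons_self) hZ.1 c
    exact h1.trans h2

/-- The chain of elementary transformations. -/
def chain : List (Fin 7 × Fin 7) :=
  [(0, 1), (2, 3), (4, 5), (6, 0), (1, 2), (3, 4), (5, 0), (2, 6), (1, 4), (0, 3)]

/-- The factor testing nondegeneracy. -/
def DD1 {S : Type*} [CommRing S] (i j : Fin 7) (Z : Fin 7 → (S × S) × (S × S)) : S :=
  dt (Z i).1 (Z j).1 * dt (Z i).2 (Z j).2 * (∏ l, if l = i then 1 else dt (Z i).1 (Z l).1) *
    (∏ l, if l = j then 1 else dt (Z j).1 (Z l).1) *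
    ((Z i).1.2 * (Z j).1.2 * (Z i).2.2 * (Z j).2.2)

/-- The polynomial testing nondegeneracy along a chain. -/
def DD {S : Type*} [CommRing S] : List (Fin 7 × Fin 7) → (Fin 7 → (S × S) × (S × S)) → S
  | [], _ => 1
  | s :: L, Z => DD1 s.1 s.2 Z * DD L (T s.1 s.2 Z)

lemma DD1_ne (i j : Fin 7) (Z : Fin 7 → (K × K) × (K × K)) : DD1 i j Z ≠ 0 ↔ ND i j Z := by
  unfold DD1
  simp only [mul_ne_zero_iff, Finset.prod_ne_zero_iff]
  constructor
  · rintro ⟨⟨⟨⟨h1, h2⟩, h3⟩, h4⟩, ⟨⟨h5, h6⟩, h7⟩, h8⟩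
    refine ⟨h1, h2, fun l hl => ?_, fun l hl => ?_, h5, h6, h7, h8⟩
    · simpa [hl] using h3 l (Finset.mem_univ l)
    · simpa [hl] using h4 l (Finset.mem_univ l)
  · rintro ⟨h1, h2, h3, h4, h5, h6, h7, h8⟩
    refine ⟨⟨⟨⟨h1, h2⟩, fun l _ => ?_⟩, fun l _ => ?_⟩, ⟨⟨h5, h6⟩, h7⟩, h8⟩
    · split_ifs with h
      · exact one_ne_zero
      · exact h3 l h
    · split_ifs with h
      · exact one_ne_zero
      · exact h4 l h

lemma DD_ne (L : List (Fin 7 × Fin 7)) (Z : Fin 7 → (K × K) × (K × K)) : DD L Z ≠ 0 ↔ NDs L Z := by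
  induction L generalizing Z with
  | nil => simp [DD, NDs]
  | cons s L ih => rw [DD, NDs, mul_ne_zero_iff, DD1_ne, ih]

lemma map_T {S R : Type*} [CommRing S] [CommRing R] (f : S →+* R) (i j : Fin 7)
    (Z : Fin 7 → (S × S) × (S × S)) :
    (fun l => emp f (T i j Z l)) = T i j (fun l => emp f (Z l)) := by
  funext l
  unfold T Ph
  split_ifs with h
  · rfl
  · have := map_Am f (Z i) (Z j) (Z l).1 (Z l).2
    exact Prod.ext this rfl

lemma map_DD1 {S R : Type*} [CommRing S] [CommRing R] (f : S →+* R) (i j : Fin 7)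
    (Z : Fin 7 → (S × S) × (S × S)) : f (DD1 i j Z) = DD1 i j (fun l => emp f (Z l)) := by
  simp [DD1, dt, emp, em, map_prod, apply_ite f]

lemma map_DD {S R : Type*} [CommRing S] [CommRing R] (f : S →+* R) (L : List (Fin 7 × Fin 7))
    (Z : Fin 7 → (S × S) × (S × S)) : f (DD L Z) = DD L (fun l => emp f (Z l)) := by
  induction L generalizing Z with
  | nil => simp [DD]
  | cons s L ih => rw [DD, DD, map_mul, map_DD1, ih, map_T]

/-- The generic configuration. -/
def gen (K : Type*) [Field K] : Fin 7 → (MvPolynomial (Fin 7 × Fin 4) K ×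
    MvPolynomial (Fin 7 × Fin 4) K) × (MvPolynomial (Fin 7 × Fin 4) K ×
    MvPolynomial (Fin 7 × Fin 4) K) :=
  fun l => ((X (l, 0), X (l, 1)), (X (l, 2), X (l, 3)))

lemma eval_gen (Z : Fin 7 → (K × K) × (K × K)) :
    (fun l => emp (eval (coordsOf K Z)) (gen K l)) = Z := by
  funext l
  simp [emp, em, gen, coordsOf]

lemma exists_ne [Infinite K] (P : MvPolynomial (Fin 7 × Fin 4) K) (hP : P ≠ 0) :
    ∃ Z : Fin 7 → (K × K) × (K × K), eval (coordsOf K Z) P ≠ 0 := by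
  by_contra hcon
  push Not at hcon
  apply hP
  apply MvPolynomial.funext
  intro v
  have := hcon (fun l => ((v (l, 0), v (l, 1)), (v (l, 2), v (l, 3))))
  rw [map_zero, ← this]
  congr 2
  funext ⟨l, r⟩
  fin_cases r <;> simp [coordsOf]
lemma cls_chain (a b m : ℤ) : cls chain (a, b, fun _ => m) =
    (7 * a + 8 * b - 28 * m, 8 * a + 7 * b - 28 * m, fun _ => 4 * a + 4 * b - 15 * m) := by
  have key : ∀ (s : Fin 7 × Fin 7) (A B A' : ℤ) (M M' : Fin 7 → ℤ), A + B - M s.1 - M s.2 = A' →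
      (∀ l, (if l = s.1 ∨ l = s.2 then B - M l else M l) = M' l) →
      st s (A, B, M) = (B, A', M') := by
    intro s A B A' M M' h1 h2
    subst h1
    have : M' = (fun l => if l = s.1 ∨ l = s.2 then B - M l else M l) := by
      funext l; exact (h2 l).symm
    rw [this]
    rfl
  have h0 : st (0, 1) (a, b, fun _ => m) =
      (b, a + b - 2 * m,
        ![b - m, b - m, m, m, m, m, m]) := by
    refine key _ _ _ _ _ _ ?_ (fun l => ?_)
    · (try simp) <;> ring
    · fin_cases l <;> simp <;> ring
  have h1 : st (2, 3) (b, a + b - 2 * m,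
        ![b - m, b - m, m, m, m, m, m]) =
      (a + b - 2 * m, a + 2 * b - 4 * m,
        ![b - m, b - m, a + b - 3 * m, a + b - 3 * m, m, m, m]) := by
    refine key _ _ _ _ _ _ ?_ (fun l => ?_)
    · (try simp) <;> ring
    · fin_cases l <;> simp <;> ring
  have h2 : st (4, 5) (a + b - 2 * m, a + 2 * b - 4 * m,
        ![b - m, b - m, a + b - 3 * m, a + b - 3 * m, m, m, m]) =
      (a + 2 * b - 4 * m, 2 * a + 3 * b - 8 * m,
        ![b - m, b - m, a + b - 3 * m, a + b - 3 * m, a + 2 * b - 5 * m, a + 2 * b - 5 * m, m]) := by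
    refine key _ _ _ _ _ _ ?_ (fun l => ?_)
    · (try simp) <;> ring
    · fin_cases l <;> simp <;> ring
  have h3 : st (6, 0) (a + 2 * b - 4 * m, 2 * a + 3 * b - 8 * m,
        ![b - m, b - m, a + b - 3 * m, a + b - 3 * m, a + 2 * b - 5 * m, a + 2 * b - 5 * m, m]) =
      (2 * a + 3 * b - 8 * m, 3 * a + 4 * b - 12 * m,
        ![2 * a + 2 * b - 7 * m, b - m, a + b - 3 * m, a + b - 3 * m, a + 2 * b - 5 * m, a + 2 * b - 5 * m, 2 * a + 3 * b - 9 * m]) := by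
    refine key _ _ _ _ _ _ ?_ (fun l => ?_)
    · (try simp) <;> ring
    · fin_cases l <;> simp <;> ring
  have h4 : st (1, 2) (2 * a + 3 * b - 8 * m, 3 * a + 4 * b - 12 * m,
        ![2 * a + 2 * b - 7 * m, b - m, a + b - 3 * m, a + b - 3 * m, a + 2 * b - 5 * m, a + 2 * b - 5 * m, 2 * a + 3 * b - 9 * m]) =
      (3 * a + 4 * b - 12 * m, 4 * a + 5 * b - 16 * m,
        ![2 * a + 2 * b - 7 * m, 3 * a + 3 * b - 11 * m, 2 * a + 3 * b - 9 * m, a + b - 3 * m, a + 2 * b - 5 * m, a + 2 * b - 5 * m, 2 * a + 3 * b - 9 * m]) := by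
    refine key _ _ _ _ _ _ ?_ (fun l => ?_)
    · (try simp) <;> ring
    · fin_cases l <;> simp <;> ring
  have h5 : st (3, 4) (3 * a + 4 * b - 12 * m, 4 * a + 5 * b - 16 * m,
        ![2 * a + 2 * b - 7 * m, 3 * a + 3 * b - 11 * m, 2 * a + 3 * b - 9 * m, a + b - 3 * m, a + 2 * b - 5 * m, a + 2 * b - 5 * m, 2 * a + 3 * b - 9 * m]) =
      (4 * a + 5 * b - 16 * m, 5 * a + 6 * b - 20 * m,
        ![2 * a + 2 * b - 7 * m, 3 * a + 3 * b - 11 * m, 2 * a + 3 * b - 9 * m, 3 * a + 4 * b - 13 * m, 3 * a + 3 * b - 11 * m, a + 2 * b - 5 * m, 2 * a + 3 * b - 9 * m]) := by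
    refine key _ _ _ _ _ _ ?_ (fun l => ?_)
    · (try simp) <;> ring
    · fin_cases l <;> simp <;> ring
  have h6 : st (5, 0) (4 * a + 5 * b - 16 * m, 5 * a + 6 * b - 20 * m,
        ![2 * a + 2 * b - 7 * m, 3 * a + 3 * b - 11 * m, 2 * a + 3 * b - 9 * m, 3 * a + 4 * b - 13 * m, 3 * a + 3 * b - 11 * m, a + 2 * b - 5 * m, 2 * a + 3 * b - 9 * m]) =
      (5 * a + 6 * b - 20 * m, 6 * a + 7 * b - 24 * m,
        ![3 * a + 4 * b - 13 * m, 3 * a + 3 * b - 11 * m, 2 * a + 3 * b - 9 * m, 3 * a + 4 * b - 13 * m, 3 * a + 3 * b - 11 * m, 4 * a + 4 * b - 15 * m, 2 * a + 3 * b - 9 * m]) := by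
    refine key _ _ _ _ _ _ ?_ (fun l => ?_)
    · (try simp) <;> ring
    · fin_cases l <;> simp <;> ring
  have h7 : st (2, 6) (5 * a + 6 * b - 20 * m, 6 * a + 7 * b - 24 * m,
        ![3 * a + 4 * b - 13 * m, 3 * a + 3 * b - 11 * m, 2 * a + 3 * b - 9 * m, 3 * a + 4 * b - 13 * m, 3 * a + 3 * b - 11 * m, 4 * a + 4 * b - 15 * m, 2 * a + 3 * b - 9 * m]) =
      (6 * a + 7 * b - 24 * m, 7 * a + 7 * b - 26 * m,
        ![3 * a + 4 * b - 13 * m, 3 * a + 3 * b - 11 * m, 4 * a + 4 * b - 15 * m, 3 * a + 4 * b - 13 * m, 3 * a + 3 * b - 11 * m, 4 * a + 4 * b - 15 * m, 4 * a + 4 * b - 15 * m]) := by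
    refine key _ _ _ _ _ _ ?_ (fun l => ?_)
    · (try simp) <;> ring
    · fin_cases l <;> simp <;> ring
  have h8 : st (1, 4) (6 * a + 7 * b - 24 * m, 7 * a + 7 * b - 26 * m,
        ![3 * a + 4 * b - 13 * m, 3 * a + 3 * b - 11 * m, 4 * a + 4 * b - 15 * m, 3 * a + 4 * b - 13 * m, 3 * a + 3 * b - 11 * m, 4 * a + 4 * b - 15 * m, 4 * a + 4 * b - 15 * m]) =
      (7 * a + 7 * b - 26 * m, 7 * a + 8 * b - 28 * m,
        ![3 * a + 4 * b - 13 * m, 4 * a + 4 * b - 15 * m, 4 * a + 4 * b - 15 * m, 3 * a + 4 * b - 13 * m, 4 * a + 4 * b - 15 * m, 4 * a + 4 * b - 15 * m, 4 * a + 4 * b - 15 * m]) := by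
    refine key _ _ _ _ _ _ ?_ (fun l => ?_)
    · (try simp) <;> ring
    · fin_cases l <;> simp <;> ring
  have h9 : st (0, 3) (7 * a + 7 * b - 26 * m, 7 * a + 8 * b - 28 * m,
        ![3 * a + 4 * b - 13 * m, 4 * a + 4 * b - 15 * m, 4 * a + 4 * b - 15 * m, 3 * a + 4 * b - 13 * m, 4 * a + 4 * b - 15 * m, 4 * a + 4 * b - 15 * m, 4 * a + 4 * b - 15 * m]) =
      (7 * a + 8 * b - 28 * m, 8 * a + 7 * b - 28 * m, fun _ => 4 * a + 4 * b - 15 * m) := by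
    refine key _ _ _ _ _ _ ?_ (fun l => ?_)
    · (try simp) <;> ring
    · fin_cases l <;> simp <;> ring
  simp only [chain, cls, h0, h1, h2, h3, h4, h5, h6, h7, h8, h9]

lemma ND_scale {i j : Fin 7} {Z : Fin 7 → (K × K) × (K × K)} {s r : Fin 7 → K}
    (hs : ∀ l, s l ≠ 0) (hr : ∀ l, r l ≠ 0) (h : ND i j Z) :
    ND i j (fun l => (s l • (Z l).1, r l • (Z l).2)) := by
  have hd : ∀ (c d : K) (u v : K × K), dt (c • u) (d • v) = c * d * dt u v := by
    intro c d u v; simp [dt]; ring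
  obtain ⟨h1, h2, h3, h4, h5, h6, h7, h8⟩ := h
  constructor <;> simp only [hd, Prod.smul_snd, smul_eq_mul]
  · exact mul_ne_zero (mul_ne_zero (hs _) (hs _)) h1
  · exact mul_ne_zero (mul_ne_zero (hr _) (hr _)) h2
  · exact fun l hl => mul_ne_zero (mul_ne_zero (hs _) (hs _)) (h3 l hl)
  · exact fun l hl => mul_ne_zero (mul_ne_zero (hs _) (hs _)) (h4 l hl)
  · exact mul_ne_zero (hs _) h5
  · exact mul_ne_zero (hs _) h6
  · exact mul_ne_zero (hr _) h7
  · exact mul_ne_zero (hr _) h8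

lemma T_scale {i j : Fin 7} {Z : Fin 7 → (K × K) × (K × K)} {s r : Fin 7 → K}
    (hs : ∀ l, s l ≠ 0) (hr : ∀ l, r l ≠ 0) :
    ∃ s' r' : Fin 7 → K, (∀ l, s' l ≠ 0) ∧ (∀ l, r' l ≠ 0) ∧
      T i j (fun l => (s l • (Z l).1, r l • (Z l).2)) =
        fun l => (s' l • (T i j Z l).1, r' l • (T i j Z l).2) := by
  refine ⟨fun l => if l = i ∨ l = j then r l else s i * s j * r i ^ 2 * r j ^ 2 * s l * r l,
    s, fun l => ?_, hs, ?_⟩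
  · dsimp only
    split_ifs
    · exact hr l
    · simp [hs, hr]
  · funext l
    unfold T Ph
    by_cases h : l = i ∨ l = j
    · simp [h]
    · simp only [h, if_false]
      refine Prod.ext ?_ rfl
      ext <;> simp [Am, dt] <;> ring

lemma NDs_scale (L : List (Fin 7 × Fin 7)) {Z : Fin 7 → (K × K) × (K × K)} {s r : Fin 7 → K}
    (hs : ∀ l, s l ≠ 0) (hr : ∀ l, r l ≠ 0) (h : NDs L Z) :
    NDs L (fun l => (s l • (Z l).1, r l • (Z l).2)) := by
  induction L generalizing Z s r with
  | nil => trivial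
  | cons t L ih =>
    refine ⟨ND_scale hs hr h.1, ?_⟩
    obtain ⟨s', r', hs', hr', e⟩ := T_scale (i := t.1) (j := t.2) (Z := Z) hs hr
    rw [e]
    exact ih hs' hr' h.2

lemma gen_ne {P : MvPolynomial (Fin 7 × Fin 4) K} {Z : Fin 7 → (K × K) × (K × K)}
    (h : eval (coordsOf K Z) P ≠ 0) : P ≠ 0 := by
  rintro rfl; simp at h

lemma exists_ND [Infinite K] {i j : Fin 7} (hij : i ≠ j) :
    ∃ Z : Fin 7 → (K × K) × (K × K), ND i j Z := by
  let f : Fin 7 → K := fun l => Infinite.natEmbedding K l.val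
  have hf : ∀ a b, a ≠ b → f a - f b ≠ 0 := by
    intro a b hab h
    apply hab
    have := (Infinite.natEmbedding K).injective (sub_eq_zero.mp h)
    exact Fin.ext this
  refine ⟨fun l => ((f l, 1), (f l, 1)), ?_⟩
  constructor <;> simp only [dt, mul_one, one_mul] <;>
    first
    | exact hf _ _ hij
    | exact one_ne_zero
    | exact fun l hl => hf _ _ (Ne.symm hl)

lemma exists_NDs [Infinite K] (L : List (Fin 7 × Fin 7)) (hL : ∀ s ∈ L, s.1 ≠ s.2) :
    ∃ Z : Fin 7 → (K × K) × (K × K), NDs L Z := by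
  induction L with
  | nil => exact ⟨0, trivial⟩
  | cons s L ih =>
    obtain ⟨Z1, h1⟩ := ih (fun t ht => hL t (List.mem_cons_of_mem _ ht))
    obtain ⟨Z2, h2⟩ := exists_ND (K := K) (hL s List.mem_cons_self)
    set P1 : MvPolynomial (Fin 7 × Fin 4) K := DD L (fun l => ((gen K l).2, (gen K l).1)) with hP1
    set P2 : MvPolynomial (Fin 7 × Fin 4) K := DD1 s.1 s.2 (gen K) with hP2
    have e1 : ∀ Z : Fin 7 → (K × K) × (K × K),
        eval (coordsOf K Z) P1 = DD L (fun l => ((Z l).2, (Z l).1)) := by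
      intro Z
      rw [hP1, map_DD]
      conv_rhs => rw [← eval_gen Z]
      rfl
    have e2 : ∀ Z : Fin 7 → (K × K) × (K × K),
        eval (coordsOf K Z) P2 = DD1 s.1 s.2 Z := by
      intro Z
      rw [hP2, map_DD1, eval_gen]
    have n1 : P1 ≠ 0 := by
      apply gen_ne (Z := fun l => ((Z1 l).2, (Z1 l).1))
      rw [e1]
      exact (DD_ne L Z1).mpr h1
    have n2 : P2 ≠ 0 := by
      apply gen_ne (Z := Z2)
      rw [e2, DD1_ne]
      exact h2
    obtain ⟨Z, hZ⟩ := exists_ne _ (mul_ne_zero n1 n2)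
    rw [map_mul, mul_ne_zero_iff, e1, e2, DD_ne, DD1_ne] at hZ
    refine ⟨Ph s.1 s.2 Z, Ph_ND hZ.2, ?_⟩
    have h3 := NDs_scale L (s := scal s.1 s.2 Z) (r := fun _ => 1) (scal_ne hZ.2)
      (fun _ => one_ne_zero) hZ.1
    convert h3 using 1
    funext l
    unfold T
    rw [Ph_Ph, one_smul]

lemma dt_hom {w : Fin 7 × Fin 4 → (Fin 7 → ℕ × ℕ)} {x y : MvPolynomial (Fin 7 × Fin 4) K ×
    MvPolynomial (Fin 7 × Fin 4) K} {a b : Fin 7 → ℕ × ℕ}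
    (h1 : x.1.IsWeightedHomogeneous w a) (h2 : x.2.IsWeightedHomogeneous w a)
    (h3 : y.1.IsWeightedHomogeneous w b) (h4 : y.2.IsWeightedHomogeneous w b) :
    (dt x y).IsWeightedHomogeneous w (a + b) := by
  unfold dt
  exact (h1.mul h4).sub (h2.mul h3)

lemma hom_DD1 {w : Fin 7 × Fin 4 → (Fin 7 → ℕ × ℕ)} (i j : Fin 7)
    (Z : Fin 7 → (MvPolynomial (Fin 7 × Fin 4) K ×
      MvPolynomial (Fin 7 × Fin 4) K) × (MvPolynomial (Fin 7 × Fin 4) K ×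
      MvPolynomial (Fin 7 × Fin 4) K)) (u v : Fin 7 → (Fin 7 → ℕ × ℕ))
    (h1 : ∀ l, (Z l).1.1.IsWeightedHomogeneous w (u l))
    (h2 : ∀ l, (Z l).1.2.IsWeightedHomogeneous w (u l))
    (h3 : ∀ l, (Z l).2.1.IsWeightedHomogeneous w (v l))
    (h4 : ∀ l, (Z l).2.2.IsWeightedHomogeneous w (v l)) :
    ∃ d, (DD1 i j Z).IsWeightedHomogeneous w d := by
  have hx : ∀ l l', (dt (Z l).1 (Z l').1).IsWeightedHomogeneous w (u l + u l') :=
    fun l l' => dt_hom (h1 _) (h2 _) (h1 _) (h2 _)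
  have hy : ∀ l l', (dt (Z l).2 (Z l').2).IsWeightedHomogeneous w (v l + v l') :=
    fun l l' => dt_hom (h3 _) (h4 _) (h3 _) (h4 _)
  have hp : ∀ i, (∏ l, if l = i then 1 else dt (Z i).1 (Z l).1).IsWeightedHomogeneous w
      (∑ l, if l = i then 0 else u i + u l) := by
    intro i
    refine IsWeightedHomogeneous.prod _ _ _ fun l _ => ?_
    split_ifs
    · exact isWeightedHomogeneous_one _ _
    · exact hx _ _
  exact ⟨_, ((((hx i j).mul (hy i j)).mul (hp i)).mul (hp j)).mul
    ((((h2 i).mul (h2 j)).mul (h4 i)).mul (h4 j))⟩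

lemma hom_DD {w : Fin 7 × Fin 4 → (Fin 7 → ℕ × ℕ)} (L : List (Fin 7 × Fin 7))
    (Z : Fin 7 → (MvPolynomial (Fin 7 × Fin 4) K ×
      MvPolynomial (Fin 7 × Fin 4) K) × (MvPolynomial (Fin 7 × Fin 4) K ×
      MvPolynomial (Fin 7 × Fin 4) K)) (u v : Fin 7 → (Fin 7 → ℕ × ℕ))
    (h1 : ∀ l, (Z l).1.1.IsWeightedHomogeneous w (u l))
    (h2 : ∀ l, (Z l).1.2.IsWeightedHomogeneous w (u l))
    (h3 : ∀ l, (Z l).2.1.IsWeightedHomogeneous w (v l))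
    (h4 : ∀ l, (Z l).2.2.IsWeightedHomogeneous w (v l)) :
    ∃ d, (DD L Z).IsWeightedHomogeneous w d := by
  induction L generalizing Z u v with
  | nil => exact ⟨0, isWeightedHomogeneous_one _ _⟩
  | cons s L ih =>
    obtain ⟨i, j⟩ := s
    obtain ⟨d1, hd1⟩ := hom_DD1 i j Z u v h1 h2 h3 h4
    have hx : ∀ l l', (dt (Z l).1 (Z l').1).IsWeightedHomogeneous w (u l + u l') :=
      fun l l' => dt_hom (h1 _) (h2 _) (h1 _) (h2 _)
    have hy : ∀ l l', (dt (Z l).2 (Z l').2).IsWeightedHomogeneous w (v l + v l') :=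
      fun l l' => dt_hom (h3 _) (h4 _) (h3 _) (h4 _)
    have term : ∀ l i j, ∀ P : MvPolynomial (Fin 7 × Fin 4) K, P.IsWeightedHomogeneous w (v i) →
        ((Z i).1.2 * (Z j).2.2 ^ 2 * dt (Z j).1 (Z l).1 * dt (Z i).2 (Z l).2 *
          P).IsWeightedHomogeneous w
          (u i + u j + 2 • v i + 2 • v j + u l + v l) := by
      intro l i j P hP
      have := ((((h2 i).mul ((h4 j).pow 2)).mul (hx j l)).mul (hy i l)).mul hP
      convert this using 1
      simp only [two_nsmul]
      abel
    have e : ∀ l i j, (u j + u i + 2 • v j + 2 • v i + u l + v l) =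
        (u i + u j + 2 • v i + 2 • v j + u l + v l) := by
      intro l i j; abel
    have A1 : ∀ l, (Am (Z i) (Z j) (Z l).1 (Z l).2).1.IsWeightedHomogeneous w
        (u i + u j + 2 • v i + 2 • v j + u l + v l) := by
      intro l
      have := term l j i _ (h3 j)
      rw [e] at this
      exact (term l i j _ (h3 i)).add this
    have A2 : ∀ l, (Am (Z i) (Z j) (Z l).1 (Z l).2).2.IsWeightedHomogeneous w
        (u i + u j + 2 • v i + 2 • v j + u l + v l) := by
      intro l
      have := term l j i _ (h4 j)
      rw [e] at this
      exact (term l i j _ (h4 i)).add this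
    obtain ⟨d2, hd2⟩ := ih (T i j Z)
      (fun l => if l = i ∨ l = j then v l else u i + u j + 2 • v i + 2 • v j + u l + v l) u
      (by intro l; unfold T Ph; split_ifs; exacts [h3 l, A1 l])
      (by intro l; unfold T Ph; split_ifs; exacts [h4 l, A2 l])
      (by intro l; unfold T Ph; split_ifs; exacts [h1 l, h1 l])
      (by intro l; unfold T Ph; split_ifs; exacts [h2 l, h2 l])
    exact ⟨_, hd1.mul hd2⟩

/-- The form cutting out the complement of the general locus. -/
def GG (K : Type*) [Field K] : MvPolynomial (Fin 7 × Fin 4) K :=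
  (∏ p : Fin 7 × Fin 4, X p) * DD chain (gen K)

lemma GG_hom : ∃ d, (GG K).IsWeightedHomogeneous (wProd 7) d := by
  have hX := isWeightedHomogeneous_X K (wProd 7)
  obtain ⟨d, hd⟩ := hom_DD (K := K) (w := wProd 7) chain (gen K)
    (fun l => Pi.single l (1, 0)) (fun l => Pi.single l (0, 1))
    (fun l => hX (l, 0)) (fun l => hX (l, 1)) (fun l => hX (l, 2)) (fun l => hX (l, 3))
  exact ⟨_, (IsWeightedHomogeneous.prod _ _ _ fun p _ => hX p).mul hd⟩

lemma GG_exists [Infinite K] : ∃ Z : Fin 7 → (K × K) × (K × K), (∀ i, IsPtRep K (Z i)) ∧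
    eval (coordsOf K Z) (GG K) ≠ 0 := by
  have h0 : GG K ≠ 0 := by
    refine mul_ne_zero (Finset.prod_ne_zero_iff.mpr fun p _ => X_ne_zero p) ?_
    obtain ⟨Z, hZ⟩ := exists_NDs (K := K) chain (by decide)
    apply gen_ne (Z := Z)
    rw [map_DD, eval_gen, DD_ne]
    exact hZ
  obtain ⟨Z, hZ⟩ := exists_ne _ h0
  refine ⟨Z, fun l => ?_, hZ⟩
  rw [GG, map_mul, map_prod] at hZ
  have h1 := Finset.prod_ne_zero_iff.mp (left_ne_zero_of_mul hZ)
  have h2 := h1 (l, 0) (Finset.mem_univ _)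
  have h3 := h1 (l, 2) (Finset.mem_univ _)
  rw [eval_X] at h2 h3
  constructor
  · intro h; apply h2; simp [coordsOf, h]
  · intro h; apply h3; simp [coordsOf, h]

lemma GG_NDs {Z : Fin 7 → (K × K) × (K × K)} (h : eval (coordsOf K Z) (GG K) ≠ 0) :
    NDs chain Z := by
  rw [GG, map_mul] at h
  have := right_ne_zero_of_mul h
  rwa [map_DD, eval_gen, DD_ne] at this

lemma mult_of_mem {p : (K × K) × (K × K)} {m : ℕ} {F : MvPolynomial (Fin 4) K}
    (h : F ∈ pointIdeal K p ^ m) : Mult p m F := by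
  unfold Mult ev
  rw [Int.toNat_natCast]
  set φ : MvPolynomial (Fin 4) K →ₐ[K] QQ K := aeval _ with hφ
  have h1 : pointIdeal K p ≤ Ideal.comap φ (Ideal.span {(X 0 : QQ K)}) := by
    unfold pointIdeal
    rw [Ideal.span_le]
    rintro x (rfl | rfl)
    · rw [SetLike.mem_coe, Ideal.mem_comap, Ideal.mem_span_singleton]
      refine ⟨C p.1.2 * X 3 - C p.1.1 * X 4, ?_⟩
      simp [hφ, em, algebraMap_eq, ← C_mul']
      ring
    · rw [SetLike.mem_coe, Ideal.mem_comap, Ideal.mem_span_singleton]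
      refine ⟨C p.2.2 * X 5 - C p.2.1 * X 6, ?_⟩
      simp [hφ, em, algebraMap_eq, ← C_mul']
      ring
  have h2 := Ideal.pow_right_mono h1 m h
  have h3 := Ideal.le_comap_pow φ m h2
  rwa [Ideal.mem_comap, Ideal.span_singleton_pow, Ideal.mem_span_singleton] at h3

lemma exists_dt_one {x : K × K} (hx : x ≠ 0) : ∃ U : K × K, dt x U = 1 := by
  by_cases h : x.1 = 0
  · have h2 : x.2 ≠ 0 := fun h2 => hx (Prod.ext h h2)
    exact ⟨(-(x.2)⁻¹, 0), by simp [dt, h2]⟩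
  · exact ⟨(0, (x.1)⁻¹), by simp [dt, h]⟩

lemma mem_of_mult {p : (K × K) × (K × K)} (hp : IsPtRep K p) {m : ℕ} {F : MvPolynomial (Fin 4) K}
    (h : Mult p m F) : F ∈ pointIdeal K p ^ m := by
  obtain ⟨U, hU⟩ := exists_dt_one hp.1
  obtain ⟨V, hV⟩ := exists_dt_one hp.2
  set J := pointIdeal K p with hJ
  let R := MvPolynomial (Fin 4) K
  let ex : Polynomial R × Polynomial R :=
    (Polynomial.C (dt gX (em C U)) : Polynomial R) • em (algebraMap K (Polynomial R)) p.1 +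
      (Polynomial.X : Polynomial R) •
        ((Polynomial.C (dt (em C p.1) gX) : Polynomial R) • em (algebraMap K (Polynomial R)) U)
  let ey : Polynomial R × Polynomial R :=
    (Polynomial.C (dt gY (em C V)) : Polynomial R) • em (algebraMap K (Polynomial R)) p.2 +
      (Polynomial.X : Polynomial R) •
        ((Polynomial.C (dt (em C p.2) gY) : Polynomial R) • em (algebraMap K (Polynomial R)) V)
  have hdvd : (Polynomial.X : Polynomial R) ^ m ∣ ev F ex ey := by
    have := h.spec (S := Polynomial R) Polynomial.X (Polynomial.C (dt gX (em C U)))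
      (Polynomial.C (dt gY (em C V)))
      ((Polynomial.C (dt (em C p.1) gX) : Polynomial R) • em (algebraMap K (Polynomial R)) U)
      ((Polynomial.C (dt (em C p.2) gY) : Polynomial R) • em (algebraMap K (Polynomial R)) V)
    rwa [Int.toNat_natCast] at this
  have jx : dt (em C p.1) gX ∈ J := by
    have : C p.1.2 * X 0 - C p.1.1 * X 1 ∈ J := Ideal.subset_span (by simp)
    have := J.neg_mem this
    convert this using 1
    simp [dt, em, gX]
  have jy : dt (em C p.2) gY ∈ J := by
    have : C p.2.2 * X 2 - C p.2.1 * X 3 ∈ J := Ideal.subset_span (by simp)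
    have := J.neg_mem this
    convert this using 1
    simp [dt, em, gY]
  have hC : ∀ c : R, Polynomial.C c ∈ reesAlgebra J := fun c => (reesAlgebra J).algebraMap_mem c
  have hK : ∀ c : K, algebraMap K (Polynomial R) c ∈ reesAlgebra J := by
    intro c
    have : algebraMap K (Polynomial R) c = Polynomial.C (C c) := rfl
    rw [this]; exact hC _
  have hXm : ∀ c ∈ J, Polynomial.X * Polynomial.C c ∈ reesAlgebra J := by
    intro c hc
    have : Polynomial.X * Polynomial.C c = Polynomial.monomial 1 c := by
      rw [Polynomial.X_mul_C, Polynomial.C_mul_X_eq_monomial]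
    rw [this]
    exact reesAlgebra.monomial_mem.mpr (by simpa using hc)
  have hmem : ev F ex ey ∈ reesAlgebra J := by
    unfold ev
    clear hdvd h
    induction F using MvPolynomial.induction_on with
    | C a => rw [aeval_C]; exact hK a
    | add P Q hP hQ => rw [map_add]; exact add_mem hP hQ
    | mul_X P i hP =>
      rw [map_mul, aeval_X]
      refine mul_mem hP ?_
      have key : ∀ (a b : R) (c d : K), b ∈ J → Polynomial.C a * algebraMap K (Polynomial R) c +
          Polynomial.X * (Polynomial.C b * algebraMap K (Polynomial R) d) ∈ reesAlgebra J := by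
        intro a b c d hb
        rw [← mul_assoc]
        exact add_mem (mul_mem (hC _) (hK _)) (mul_mem (hXm _ hb) (hK _))
      fin_cases i
      · exact key _ _ _ _ jx
      · exact key _ _ _ _ jx
      · exact key _ _ _ _ jy
      · exact key _ _ _ _ jy
  have hev : Polynomial.eval 1 (ev F ex ey) = F := by
    let g : Polynomial R →ₐ[K] R := (Polynomial.aeval (1 : R)).restrictScalars K
    have hg : ∀ P, g P = Polynomial.eval 1 P := fun P => Polynomial.coe_aeval_eq_eval (1 : R) ▸ rfl
    have hgC : ∀ c : K, Polynomial.eval 1 (algebraMap K (Polynomial R) c) = (C c : R) := by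
      intro c
      have : algebraMap K (Polynomial R) c = Polynomial.C (C c) := rfl
      rw [this, Polynomial.eval_C]
    have hU' : (C p.1.1 * C U.2 - C p.1.2 * C U.1 : R) = 1 := by
      have := congrArg (C (σ := Fin 4)) hU
      simpa [dt] using this
    have hV' : (C p.2.1 * C V.2 - C p.2.2 * C V.1 : R) = 1 := by
      have := congrArg (C (σ := Fin 4)) hV
      simpa [dt] using this
    have gx : em g ex = gX := by
      ext1
      · simp only [em, hg, ex, Prod.fst_add, Prod.smul_fst, smul_eq_mul, Polynomial.eval_add,
          Polynomial.eval_mul, Polynomial.eval_C, Polynomial.eval_X, hgC, dt, gX]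
        linear_combination (X 0 : R) * hU'
      · simp only [em, hg, ex, Prod.snd_add, Prod.smul_snd, smul_eq_mul, Polynomial.eval_add,
          Polynomial.eval_mul, Polynomial.eval_C, Polynomial.eval_X, hgC, dt, gX]
        linear_combination (X 1 : R) * hU'
    have gy : em g ey = gY := by
      ext1
      · simp only [em, hg, ey, Prod.fst_add, Prod.smul_fst, smul_eq_mul, Polynomial.eval_add,
          Polynomial.eval_mul, Polynomial.eval_C, Polynomial.eval_X, hgC, dt, gY]
        linear_combination (X 2 : R) * hV'
      · simp only [em, hg, ey, Prod.snd_add, Prod.smul_snd, smul_eq_mul, Polynomial.eval_add,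
          Polynomial.eval_mul, Polynomial.eval_C, Polynomial.eval_X, hgC, dt, gY]
        linear_combination (X 3 : R) * hV'
    rw [← hg, map_ev, gx, gy, ev_gen]
  rw [← hev, Polynomial.eval_eq_sum]
  refine Ideal.sum_mem _ fun n _ => ?_
  by_cases hn : n < m
  · rw [Polynomial.X_pow_dvd_iff.mp hdvd n hn]; simp
  · dsimp only
    rw [one_pow, mul_one]
    exact Ideal.pow_le_pow_right (not_lt.mp hn) ((mem_reesAlgebra_iff J _).mp hmem n)


lemma lower {Z : Fin 7 → (K × K) × (K × K)} (hZ : NDs chain Z) {m : ℕ} {F : MvPolynomial (Fin 4) K}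
    {d : ℕ × ℕ} (hF : F ∈ symbolicPower K Z m) (h0 : F ≠ 0) (hd : F.IsWeightedHomogeneous w4 d) :
    56 * m ≤ 15 * (d.1 + d.2) := by
  have h1 : GoodC Z (d.1, d.2, fun _ => (m : ℤ)) := by
    refine ⟨F, d.1, d.2, rfl, rfl, h0, hd, fun l => ?_⟩
    exact mult_of_mem ((Submodule.mem_iInf _).mp hF l)
  have h2 := (good_run chain (by decide) Z hZ _).mpr h1
  rw [cls_chain] at h2
  obtain ⟨F', a', b', ha, hb, -⟩ := h2
  dsimp only at ha hb
  omega

lemma upper {Z : Fin 7 → (K × K) × (K × K)} (hrep : ∀ l, IsPtRep K (Z l)) (hZ : NDs chain Z)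
    (m n : ℕ) (hmn : m ≤ 15 * n) :
    ∃ F ∈ symbolicPower K Z m, F ≠ 0 ∧ ∃ d : ℕ × ℕ, d.1 + d.2 = 56 * n ∧
      F.IsWeightedHomogeneous w4 d := by
  have h1 : GoodC (run chain Z) (cls chain (28 * n, 28 * n, fun _ => 15 * (n : ℤ))) := by
    rw [cls_chain]
    refine ⟨1, 0, 0, ?_, ?_, one_ne_zero, isWeightedHomogeneous_one _ _, fun l => ?_⟩
    · dsimp only; push_cast; ring
    · dsimp only; push_cast; ring
    · have : ((4 : ℤ) * (28 * n) + 4 * (28 * n) - 15 * (15 * (n : ℤ))).toNat = 0 := by omega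
      unfold Mult
      dsimp only
      rw [this, pow_zero]
      exact one_dvd _
  have h2 := (good_run chain (by decide) Z hZ _).mp h1
  obtain ⟨F, a', b', ha, hb, h0, hF, hm⟩ := h2
  dsimp only at ha hb hm
  refine ⟨F, ?_, h0, (a', b'), by dsimp only; omega, hF⟩
  refine (Submodule.mem_iInf _).mpr fun l => ?_
  refine Ideal.pow_le_pow_right hmn (mem_of_mult (hrep l) ?_)
  have := hm l
  push_cast
  exact this

lemma alpha_ge {Z : Fin 7 → (K × K) × (K × K)} (hrep : ∀ l, IsPtRep K (Z l)) (hZ : NDs chain Z)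
    (m : ℕ) : 56 * m ≤ 15 * alpha K (symbolicPower K Z m) := by
  have hne : {t | ∃ F ∈ symbolicPower K Z m, F ≠ 0 ∧ ∃ d : ℕ × ℕ, d.1 + d.2 = t ∧
      F.IsWeightedHomogeneous w4 d}.Nonempty := ⟨56 * m, upper hrep hZ m m (by omega)⟩
  obtain ⟨F, hF, h0, d, hd, hh⟩ := Nat.sInf_mem hne
  have := lower hZ hF h0 hh
  rw [hd] at this
  exact this

lemma alpha_le {Z : Fin 7 → (K × K) × (K × K)} (hrep : ∀ l, IsPtRep K (Z l)) (hZ : NDs chain Z)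
    (m : ℕ) : 15 * alpha K (symbolicPower K Z m) ≤ 56 * (m + 15) := by
  have h1 : alpha K (symbolicPower K Z m) ≤ 56 * (m / 15 + 1) :=
    Nat.sInf_le (upper hrep hZ m (m / 15 + 1) (by omega))
  omega

lemma tendsto_main {Z : Fin 7 → (K × K) × (K × K)} (hrep : ∀ l, IsPtRep K (Z l))
    (hZ : NDs chain Z) :
    Filter.Tendsto (fun m : ℕ => (alpha K (symbolicPower K Z m) : ℝ) / m)
      Filter.atTop (nhds (56 / 15 : ℝ)) := by
  have hlim : Filter.Tendsto (fun m : ℕ => (56 / 15 : ℝ) + 56 / (m : ℝ)) Filter.atTop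
      (nhds (56 / 15 : ℝ)) := by
    have := (tendsto_const_div_atTop_nhds_zero_nat (56 : ℝ)).const_add (56 / 15 : ℝ)
    simpa using this
  refine tendsto_of_tendsto_of_tendsto_of_le_of_le' tendsto_const_nhds hlim ?_ ?_
  · filter_upwards [Filter.eventually_gt_atTop 0] with m hm
    have hm' : (0 : ℝ) < m := by exact_mod_cast hm
    have h : (56 : ℝ) * m ≤ 15 * alpha K (symbolicPower K Z m) := by
      exact_mod_cast alpha_ge hrep hZ m
    rw [le_div_iff₀ hm']
    linarith
  · filter_upwards [Filter.eventually_gt_atTop 0] with m hm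
    have hm' : (0 : ℝ) < m := by exact_mod_cast hm
    have h : (15 : ℝ) * alpha K (symbolicPower K Z m) ≤ 56 * (m + 15) := by
      exact_mod_cast alpha_le hrep hZ m
    rw [div_le_iff₀ hm', add_mul, div_mul_cancel₀ _ hm'.ne']
    linarith


end General

end Cremona

/-- For `7` general points of `P^1 × P^1`, `γ(I) = 56/15`. -/
theorem gamma_general_points_7 {k : Type*} [Field k] [IsAlgClosed k] :
    GeneralPosition k 7 (fun Z =>
      Filter.Tendsto
        (fun m : ℕ => (alpha k (symbolicPower k Z m) : ℝ) / m)
        Filter.atTop (nhds (56 / 15 : ℝ))) := by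
  obtain ⟨d, hd⟩ := Cremona.GG_hom (K := k)
  haveI : Infinite k := inferInstance
  refine ⟨Cremona.GG k, d, hd, Cremona.GG_exists, fun Z hrep _ hZ => ?_⟩
  exact Cremona.tendsto_main hrep (Cremona.GG_NDs hZ)
end
end

section
/- For 8 general points of P^1 x P^1, the ideal I of the points satisfies γ(I) = 4; that is, there is a nonempty Zariski-open subset U of (P^1 x P^1)^8 such that for every 8-tuple of pairwise distinct points lying in U, with I the ideal of these points, α(I^(m))/m tends to 4 as m → ∞. -/
open MvPolynomial

noncomputable section

variable (k : Type*) [Field k]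

namespace Aff

section Basic
variable {K : Type*} [Field K]

/-- Bivariate polynomials; inner variable `x`, outer variable `y`. -/
abbrev Biv (K : Type*) [Field K] := Polynomial (Polynomial K)

/-- Polynomial with a prescribed rectangle of coefficients. -/
def pol {p q : ℕ} (c : Fin p × Fin q → K) : Biv K :=
  ∑ s, Polynomial.monomial (s.2 : ℕ) (Polynomial.monomial (s.1 : ℕ) (c s))

lemma coeff_pol {p q : ℕ} (c : Fin p × Fin q → K) (i j : ℕ) :
    ((pol c).coeff j).coeff i = if h : i < p ∧ j < q then c (⟨i, h.1⟩, ⟨j, h.2⟩) else 0 := by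
  unfold pol
  rw [Polynomial.finsetSum_coeff, Polynomial.finsetSum_coeff]
  simp only [Polynomial.coeff_monomial]
  split_ifs with h
  · rw [Finset.sum_eq_single (⟨i, h.1⟩, ⟨j, h.2⟩)]
    · simp
    · rintro ⟨a, b⟩ _ hne
      by_cases hb : (b : ℕ) = j
      · simp only [hb, if_true, Polynomial.coeff_monomial]
        rw [if_neg]
        intro ha
        apply hne
        ext <;> simp [ha, hb]
      · simp [hb]
    · simp
  · apply Finset.sum_eq_zero
    rintro ⟨a, b⟩ _
    by_cases hb : (b : ℕ) = j
    · simp only [hb, if_true, Polynomial.coeff_monomial]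
      rw [if_neg]
      intro ha
      exact h ⟨ha ▸ a.2, hb ▸ b.2⟩
    · simp [hb]

def Box (p q : ℕ) (D : Biv K) : Prop :=
  ∀ i j, (p ≤ i ∨ q ≤ j) → (D.coeff j).coeff i = 0

lemma box_pol {p q : ℕ} (c : Fin p × Fin q → K) : Box p q (pol c) := by
  intro i j h
  rw [coeff_pol, dif_neg]
  omega

lemma pol_of_box {p q : ℕ} {D : Biv K} (h : Box p q D) :
    pol (fun s : Fin p × Fin q => (D.coeff s.2).coeff s.1) = D := by
  ext j i
  rw [coeff_pol]
  split_ifs with h'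
  · rfl
  · rw [h]; omega

lemma pol_eq_zero {p q : ℕ} {c : Fin p × Fin q → K} (h : pol c = 0) : c = 0 := by
  ext ⟨i, j⟩
  have := coeff_pol c i j
  rw [h, dif_pos ⟨i.2, j.2⟩] at this
  simpa using this.symm

lemma Box.mul {p q p' q' : ℕ} {D F : Biv K} (hD : Box p q D) (hF : Box (p' + 1) (q' + 1) F) :
    Box (p + p') (q + q') (D * F) := by
  intro i j h
  rw [Polynomial.coeff_mul, Polynomial.finsetSum_coeff]
  apply Finset.sum_eq_zero
  rintro ⟨j1, j2⟩ hj
  rw [Polynomial.coeff_mul]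
  apply Finset.sum_eq_zero
  rintro ⟨i1, i2⟩ hi
  have hi := Finset.HasAntidiagonal.mem_antidiagonal.mp hi
  have hj := Finset.HasAntidiagonal.mem_antidiagonal.mp hj
  simp only at hi hj ⊢
  by_cases h1 : p ≤ i1 ∨ q ≤ j1
  · rw [hD _ _ h1, zero_mul]
  · rw [hF i2 j2 (by omega), mul_zero]

lemma Box.add {p q : ℕ} {D F : Biv K} (hD : Box p q D) (hF : Box p q F) : Box p q (D + F) := by
  intro i j h
  simp [hD i j h, hF i j h]

/-- Degree in the inner variable. -/
def dx (D : Biv K) : ℕ := (Polynomial.Bivariate.swap D).natDegree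

lemma coeff_swap (D : Biv K) (i j : ℕ) :
    ((Polynomial.Bivariate.swap D).coeff i).coeff j = (D.coeff j).coeff i := by
  induction D using Polynomial.induction_on' with
  | add p q hp hq => simp [hp, hq]
  | monomial n a =>
    induction a using Polynomial.induction_on' with
    | add p q hp hq => simp [hp, hq]
    | monomial m r =>
      rw [Polynomial.Bivariate.swap_monomial_monomial]
      simp only [Polynomial.coeff_monomial]
      by_cases h1 : n = j <;> by_cases h2 : m = i <;> simp [h1, h2, Polynomial.coeff_monomial]

lemma box_deg (D : Biv K) : Box (dx D + 1) (D.natDegree + 1) D := by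
  intro i j h
  rcases h with h | h
  · have : (Polynomial.Bivariate.swap D).coeff i = 0 :=
      Polynomial.coeff_eq_zero_of_natDegree_lt (by unfold dx at h; omega)
    rw [← coeff_swap, this]; simp
  · have : D.coeff j = 0 := Polynomial.coeff_eq_zero_of_natDegree_lt (by omega)
    rw [this]; simp

lemma natDegree_le_of_box {p q : ℕ} {D : Biv K} (h : Box p (q + 1) D) : D.natDegree ≤ q := by
  rw [Polynomial.natDegree_le_iff_coeff_eq_zero]
  intro j hj
  ext i
  rw [h i j (by omega)]; simp

lemma dx_le_of_box {p q : ℕ} {D : Biv K} (h : Box (p + 1) q D) : dx D ≤ p := by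
  unfold dx
  rw [Polynomial.natDegree_le_iff_coeff_eq_zero]
  intro j hj
  ext i
  rw [coeff_swap, h j i (by omega)]; simp

lemma dx_mul {D E : Biv K} (hD : D ≠ 0) (hE : E ≠ 0) : dx (D * E) = dx D + dx E := by
  unfold dx
  rw [map_mul, Polynomial.natDegree_mul]
  · simpa using hD
  · simpa using hE

lemma approx (g : Biv K) (v : K) (h0 : Polynomial.X ∣ g.eval (Polynomial.C v))
    (h1 : ((Polynomial.derivative g).eval (Polynomial.C v)).eval 0 ≠ 0) (n : ℕ) :
    ∃ φ : Polynomial K, Polynomial.X ∣ φ - Polynomial.C v ∧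
      Polynomial.X ^ (n + 1) ∣ g.eval φ := by
  induction n with
  | zero => exact ⟨Polynomial.C v, by simp, by simpa using h0⟩
  | succ n ih =>
    obtain ⟨φ, hφ, h, hh⟩ := ih
    set d := (Polynomial.derivative g).eval φ with hd
    have hd0 : d.eval 0 ≠ 0 := by
      have : Polynomial.X ∣ d - (Polynomial.derivative g).eval (Polynomial.C v) :=
        hφ.trans (Polynomial.sub_dvd_eval_sub _ _ _)
      rw [Polynomial.X_dvd_iff, Polynomial.coeff_zero_eq_eval_zero, Polynomial.eval_sub] at this
      rw [sub_eq_zero.mp this]; exact h1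
    set c : K := - h.eval 0 / d.eval 0 with hc
    obtain ⟨r, hr⟩ := Polynomial.binomExpansion g φ (Polynomial.C c * Polynomial.X ^ (n + 1))
    refine ⟨φ + Polynomial.C c * Polynomial.X ^ (n + 1), ?_, ?_⟩
    · rw [add_sub_right_comm]
      exact dvd_add hφ ((dvd_pow_self _ (by omega)).mul_left _)
    · rw [hr, hh, ← hd]
      have h2 : Polynomial.X ∣ h + d * Polynomial.C c := by
        rw [Polynomial.X_dvd_iff, Polynomial.coeff_zero_eq_eval_zero]
        simp [hc]; field_simp; simp
      obtain ⟨t, ht⟩ := h2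
      refine ⟨t + r * Polynomial.C c ^ 2 * Polynomial.X ^ n, ?_⟩
      linear_combination (Polynomial.X ^ (n + 1)) * ht

/-- blow-up chart substitution at `(u,v)`. -/
def blow (u v : K) : Biv K →ₐ[K] Biv K :=
  Polynomial.aevalAeval (Polynomial.C (Polynomial.C u) + Polynomial.X)
    (Polynomial.C (Polynomial.C v) + Polynomial.C Polynomial.X * Polynomial.X)

lemma blow_spec (u v : K) (ψ : Polynomial K) (D : Biv K) :
    Polynomial.aevalAeval ψ (Polynomial.X : Polynomial K) (blow u v D) =
      Polynomial.aevalAeval (Polynomial.C u + Polynomial.X)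
        (Polynomial.C v + ψ * Polynomial.X) D := by
  have : (Polynomial.aevalAeval ψ (Polynomial.X : Polynomial K)).comp (blow u v) =
      Polynomial.aevalAeval (Polynomial.C u + Polynomial.X)
        (Polynomial.C v + ψ * Polynomial.X) := by
    unfold blow
    ext <;> simp [← Polynomial.algebraMap_eq]
    rw [mul_comm]
  exact DFunLike.congr_fun this D

lemma dvd_spec {u v : K} {m : ℕ} {D : Biv K} (h : Polynomial.X ^ m ∣ blow u v D)
    (ψ : Polynomial K) : Polynomial.X ^ m ∣ Polynomial.aevalAeval (Polynomial.C u + Polynomial.X)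
        (Polynomial.C v + ψ * Polynomial.X) D := by
  rw [← blow_spec]
  have := map_dvd (Polynomial.aevalAeval ψ (Polynomial.X : Polynomial K)) h
  simpa using this

/-- `F(u+T, Y)` -/
def shift (u : K) (F : Biv K) : Biv K :=
  F.map (Polynomial.compRingHom (Polynomial.C u + Polynomial.X))

lemma eval_shift (u : K) (F : Biv K) (φ : Polynomial K) :
    (shift u F).eval φ = Polynomial.aevalAeval (Polynomial.C u + Polynomial.X) φ F := by
  unfold shift
  induction F using Polynomial.induction_on' with
  | add p q hp hq => simp only [Polynomial.map_add, Polynomial.eval_add, map_add, hp, hq]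
  | monomial n a =>
    simp [Polynomial.comp, Polynomial.eval_map, Polynomial.aeval_def, Polynomial.algebraMap_eq]

lemma eval_shift_zero (u v : K) (F : Biv K) :
    ((shift u F).eval (Polynomial.C v)).eval 0 = Polynomial.evalEval u v F := by
  unfold shift Polynomial.evalEval
  induction F using Polynomial.induction_on' with
  | add p q hp hq => simp only [Polynomial.map_add, Polynomial.eval_add, hp, hq]
  | monomial n a => simp

lemma derivative_shift (u : K) (F : Biv K) :
    Polynomial.derivative (shift u F) = shift u (Polynomial.derivative F) := by
  unfold shift
  rw [Polynomial.derivative_map]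

lemma not_sq_dvd {u v : K} {F : Biv K}
    (h1 : Polynomial.evalEval u v (Polynomial.derivative F) ≠ 0) :
    ¬ Polynomial.X ^ 2 ∣ blow u v F := by
  intro h
  have a0 := dvd_spec h 0
  have a1 := dvd_spec h 1
  rw [← eval_shift] at a0 a1
  simp only [zero_mul, add_zero, one_mul] at a0 a1
  obtain ⟨r, hr⟩ := Polynomial.binomExpansion (shift u F) (Polynomial.C v) Polynomial.X
  rw [hr] at a1
  have a2 : Polynomial.X ^ 2 ∣
      Polynomial.eval (Polynomial.C v) (Polynomial.derivative (shift u F)) * Polynomial.X := by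
    have := (dvd_sub a1 a0)
    have e : ∀ a b c : Polynomial K, a + b + c - a = b + c := by intros; ring
    rw [e] at this
    exact (dvd_add_left (Dvd.intro_left _ rfl)).mp this
  rw [pow_two] at a2
  have a3 := (mul_dvd_mul_iff_right Polynomial.X_ne_zero).mp a2
  rw [Polynomial.X_dvd_iff, Polynomial.coeff_zero_eq_eval_zero, derivative_shift,
    eval_shift_zero] at a3
  exact h1 a3

lemma dvd_blow {u v : K} {F : Biv K} (h0 : Polynomial.evalEval u v F = 0) :
    Polynomial.X ∣ blow u v F := by
  rw [Polynomial.X_dvd_iff, Polynomial.coeff_zero_eq_eval_zero]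
  have : ∀ F : Biv K, (blow u v F).eval 0 = Polynomial.C (Polynomial.evalEval u v F) := by
    intro F
    unfold blow Polynomial.evalEval
    induction F using Polynomial.induction_on' with
    | add p q hp hq => simp only [map_add, Polynomial.eval_add, hp, hq]
    | monomial n a =>
      induction a using Polynomial.induction_on' with
      | add p q hp hq => simp only [map_add, Polynomial.eval_add, hp, hq]
      | monomial m r =>
        simp [← Polynomial.C_mul_X_pow_eq_monomial,
          Polynomial.algebraMap_eq]
  rw [this, h0, map_zero]

/-- multiplicity of the residual. -/
lemma residual {u v : K} {F D : Biv K} {m : ℕ} (h0 : Polynomial.evalEval u v F = 0)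
    (h1 : Polynomial.evalEval u v (Polynomial.derivative F) ≠ 0)
    (h : Polynomial.X ^ m ∣ blow u v (F * D)) : Polynomial.X ^ (m - 1) ∣ blow u v D := by
  rcases m with _ | m
  · simp
  obtain ⟨f, hf⟩ := dvd_blow h0
  have hn := not_sq_dvd h1
  rw [map_mul, hf, pow_succ', mul_assoc] at h
  have h' := (mul_dvd_mul_iff_left Polynomial.X_ne_zero).mp h
  refine Polynomial.prime_X.pow_dvd_of_dvd_mul_left _ ?_ h'
  rintro ⟨t, rfl⟩
  exact hn ⟨t, by rw [hf]; ring⟩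

/-- the elimination polynomial vanishes to order `m`. -/
lemma elim_dvd {u v : K} {F D U V : Biv K} {r : Polynomial K} {m : ℕ}
    (h0 : Polynomial.evalEval u v F = 0)
    (h1 : Polynomial.evalEval u v (Polynomial.derivative F) ≠ 0)
    (h : Polynomial.X ^ m ∣ blow u v D) (hr : U * F + V * D = Polynomial.C r) :
    (Polynomial.X - Polynomial.C u) ^ m ∣ r := by
  obtain ⟨φ, ⟨ψ, hψ⟩, hφ⟩ := approx (shift u F) v
    (by rw [Polynomial.X_dvd_iff, Polynomial.coeff_zero_eq_eval_zero, eval_shift_zero, h0])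
    (by rw [derivative_shift, eval_shift_zero]; exact h1) m
  have hφ' : φ = Polynomial.C v + ψ * Polynomial.X := by rw [mul_comm, ← hψ]; ring
  have hD := dvd_spec h ψ
  rw [eval_shift] at hφ
  rw [← hφ'] at hD
  have hF := (pow_dvd_pow Polynomial.X (Nat.le_succ m)).trans hφ
  have h3 : Polynomial.X ^ m ∣ Polynomial.aevalAeval (Polynomial.C u + Polynomial.X) φ
      (Polynomial.C r) := by
    rw [← hr, map_add, map_mul, map_mul]
    exact dvd_add (hF.mul_left _) (hD.mul_left _)
  rw [← eval_shift] at h3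
  unfold shift at h3
  simp only [Polynomial.map_C, Polynomial.eval_C, Polynomial.coe_compRingHom_apply] at h3
  have h4 := map_dvd (Polynomial.compRingHom (Polynomial.X - Polynomial.C u)) h3
  simp only [map_pow, Polynomial.coe_compRingHom_apply, Polynomial.X_comp,
    Polynomial.comp_assoc] at h4
  simpa using h4

end Basic

section Main
variable {K : Type*} [Field K]

lemma pol_add {p q : ℕ} (c d : Fin p × Fin q → K) : pol (c + d) = pol c + pol d := by
  unfold pol
  simp [Finset.sum_add_distrib]

lemma pol_smul {p q : ℕ} (a : K) (c : Fin p × Fin q → K) : pol (a • c) = a • pol c := by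
  unfold pol
  rw [Finset.smul_sum]
  refine Finset.sum_congr rfl fun s _ => ?_
  rw [Pi.smul_apply, Polynomial.smul_monomial, Polynomial.smul_monomial]

lemma exists_elim {F D : Biv K} (hF : Box 3 3 F) (hp : Prime F) (hdeg : F.natDegree = 2)
    (hFD : ¬ F ∣ D) : ∃ (U V : Biv K) (r : Polynomial K), U * F + V * D = Polynomial.C r ∧
      r ≠ 0 ∧ r.natDegree ≤ 2 * (dx D + D.natDegree) := by
  set a := dx D with ha
  set b := D.natDegree with hb
  set e := 2 * (a + b) with he
  let Φ : ((Fin (e - 1) × Fin b → K) × (Fin (e - a + 1) × Fin 2 → K)) →ₗ[K]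
      (Fin (e + 1) × Fin (b + 1) → K) :=
    { toFun := fun c s => ((pol c.1 * F + pol c.2 * D).coeff (s.2 + 1)).coeff s.1
      map_add' := by
        intro c d
        ext s
        simp only [Prod.fst_add, Prod.snd_add, pol_add, add_mul, Polynomial.coeff_add,
          Pi.add_apply]
        ring
      map_smul' := by
        intro t c
        ext s
        simp only [Prod.smul_fst, Prod.smul_snd, pol_smul, smul_mul_assoc, ← smul_add,
          Polynomial.coeff_smul, Pi.smul_apply, RingHom.id_apply] }
  have hker : LinearMap.ker Φ ≠ ⊥ := by
    apply LinearMap.ker_ne_bot_of_finrank_lt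
    simp only [Module.finrank_prod, Module.finrank_fintype_fun_eq_card, Fintype.card_prod,
      Fintype.card_fin]
    have h1 : e - a + 1 = a + 2 * b + 1 := by omega
    rw [h1]
    rcases Nat.eq_zero_or_pos b with hb0 | hb0
    · rw [he, hb0]; omega
    · obtain ⟨f, hf⟩ : ∃ f, e = f + 1 := ⟨e - 1, by omega⟩
      rw [hf]
      simp only [Nat.add_sub_cancel]
      nlinarith
  obtain ⟨c, hc, hc0⟩ := Submodule.exists_mem_ne_zero_of_ne_bot hker
  set R := pol c.1 * F + pol c.2 * D with hR
  have hbox : Box (e + 1) (b + 2) R := by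
    apply Box.add
    · rcases Nat.eq_zero_or_pos b with hb0 | hb0
      · have : pol c.1 = 0 := by
          unfold pol
          apply Finset.sum_eq_zero
          rintro ⟨x, y⟩
          exact absurd y.2 (by omega)
        rw [this, zero_mul]
        intro i j _; simp
      · have := (box_pol c.1).mul (p' := 2) (q' := 2) hF
        intro i j h
        exact this i j (by omega)
    · have := (box_pol c.2).mul (box_deg D)
      intro i j h
      exact this i j (by omega)
  have hRC : R = Polynomial.C (R.coeff 0) := by
    ext j i
    rcases j with _ | j
    · simp
    · rw [Polynomial.coeff_C_succ, Polynomial.coeff_zero]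
      by_cases h : e + 1 ≤ i ∨ b + 2 ≤ j + 1
      · exact hbox _ _ h
      · have := congrFun (LinearMap.mem_ker.mp hc) (⟨i, by omega⟩, ⟨j, by omega⟩)
        exact this
  refine ⟨pol c.1, pol c.2, R.coeff 0, hRC, ?_, ?_⟩
  · intro h0
    rw [h0, map_zero] at hRC
    have hF0 := hp.ne_zero
    have hV : pol c.2 = 0 := by
      by_contra hV
      have hd : F ∣ pol c.2 * D := by
        rw [hR] at hRC
        exact ⟨- pol c.1, by linear_combination hRC⟩
      rcases hp.dvd_or_dvd hd with h | h
      · have := Polynomial.natDegree_le_of_dvd h hV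
        have h2 := natDegree_le_of_box (q := 1) (box_pol c.2)
        omega
      · exact hFD h
    have hU : pol c.1 = 0 := by
      rw [hR, hV, zero_mul, add_zero] at hRC
      exact (mul_eq_zero.mp hRC).resolve_right hF0
    exact hc0 (Prod.ext (pol_eq_zero hU) (pol_eq_zero hV))
  · rw [Polynomial.natDegree_le_iff_coeff_eq_zero]
    intro i hi
    exact hbox i 0 (by omega)

/-- Affine genericity. -/
structure Good (u v : Fin 8 → K) : Prop where
  g1 : ∀ S : Finset (Fin 3 × Fin 3), S ≠ Finset.univ → ∀ e : S ↪ Fin 8,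
    ∀ c : Fin 3 × Fin 3 → K, (∀ s, s ∉ S → c s = 0) →
    (∀ t, Polynomial.evalEval (u (e t)) (v (e t)) (pol c) = 0) → c = 0
  g2 : ∀ i, ∀ c : Fin 3 × Fin 3 → K,
    (∀ j, Polynomial.evalEval (u j) (v j) (pol c) = 0) →
    Polynomial.evalEval (u i) (v i) (Polynomial.derivative (pol c)) = 0 → c = 0

open Classical in
def zeros (u v : Fin 8 → K) (F : Biv K) : Finset (Fin 8) :=
  Finset.univ.filter fun i => Polynomial.evalEval (u i) (v i) F = 0

lemma mem_zeros {u v : Fin 8 → K} {F : Biv K} {i : Fin 8} :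
    i ∈ zeros u v F ↔ Polynomial.evalEval (u i) (v i) F = 0 := by
  simp [zeros]

lemma Good.card_lt {u v : Fin 8 → K} (h : Good u v) (S : Finset (Fin 3 × Fin 3))
    (hS : S ≠ Finset.univ) (c : Fin 3 × Fin 3 → K) (hc : ∀ s, s ∉ S → c s = 0) (hc0 : c ≠ 0) :
    (zeros u v (pol c)).card < S.card := by
  by_contra hlt
  push Not at hlt
  have : Nonempty (S ↪ (zeros u v (pol c))) := by
    apply Function.Embedding.nonempty_of_card_le
    simpa using hlt
  obtain ⟨e⟩ := this
  refine hc0 (h.g1 S hS (e.trans (Function.Embedding.subtype _)) c hc fun t => ?_)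
  exact mem_zeros.mp (e t).2

lemma Good.coeff_ne {u v : Fin 8 → K} (h : Good u v) {c : Fin 3 × Fin 3 → K} (hc0 : c ≠ 0)
    (hz : ∀ j, Polynomial.evalEval (u j) (v j) (pol c) = 0) (s : Fin 3 × Fin 3) : c s ≠ 0 := by
  intro hs
  have := h.card_lt (Finset.univ.erase s) (by simp [Finset.erase_eq_self]) c (by
    intro t ht
    have : t = s := by simpa using ht
    rw [this, hs]) hc0
  have h8 : zeros u v (pol c) = Finset.univ := by
    ext i; simp [mem_zeros, hz]
  rw [h8] at this
  simp at this

lemma Good.factor_lt {u v : Fin 8 → K} (h : Good u v) {P : Biv K} (hP : P ≠ 0) {p q : ℕ}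
    (hb : Box (p + 1) (q + 1) P) (hp : p ≤ 2) (hq : q ≤ 2) (hne : p + q < 4) :
    (zeros u v P).card < (p + 1) * (q + 1) := by
  have hb3 : Box 3 3 P := fun i j hij => hb i j (by omega)
  have e := pol_of_box hb3
  set c : Fin 3 × Fin 3 → K := fun s => (P.coeff s.2).coeff s.1 with hc
  have hc0 : c ≠ 0 := by
    intro h0
    apply hP
    rw [← e, h0]
    unfold pol
    simp
  have := h.card_lt ((Finset.univ.filter fun x : Fin 3 => (x : ℕ) ≤ p) ×ˢ
    (Finset.univ.filter fun x : Fin 3 => (x : ℕ) ≤ q)) (by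
      intro hh
      have h2 : ((2, 2) : Fin 3 × Fin 3) ∈ (Finset.univ : Finset (Fin 3 × Fin 3)) :=
        Finset.mem_univ _
      rw [← hh] at h2
      simp at h2
      omega) c (by
      intro s hs
      apply hb
      simp at hs
      by_cases h1 : (s.1 : ℕ) ≤ p
      · have := hs h1; omega
      · omega) hc0
  rw [e, Finset.card_product] at this
  refine this.trans_le (Nat.mul_le_mul ?_ ?_)
  · interval_cases p <;> decide
  · interval_cases q <;> decide

lemma Good.prime {u v : Fin 8 → K} (h : Good u v) {c : Fin 3 × Fin 3 → K} (hc0 : c ≠ 0)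
    (hz : ∀ j, Polynomial.evalEval (u j) (v j) (pol c) = 0) :
    Prime (pol c) ∧ (pol c).natDegree = 2 ∧ dx (pol c) = 2 := by
  have h22 := h.coeff_ne hc0 hz (2, 2)
  have hco : ((pol c).coeff 2).coeff 2 ≠ 0 := by
    rw [coeff_pol]; simpa using h22
  have hny : (pol c).natDegree = 2 := by
    apply le_antisymm (natDegree_le_of_box (box_pol c))
    apply Polynomial.le_natDegree_of_ne_zero
    intro h0; rw [h0] at hco; simp at hco
  have hnx : dx (pol c) = 2 := by
    apply le_antisymm (dx_le_of_box (box_pol c))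
    apply Polynomial.le_natDegree_of_ne_zero
    intro h0
    rw [← coeff_swap, h0] at hco; simp at hco
  refine ⟨?_, hny, hnx⟩
  rw [← irreducible_iff_prime]
  have hunit : ∀ P : Biv K, P ≠ 0 → dx P = 0 → P.natDegree = 0 → IsUnit P := by
    intro P hP h1 h2
    have hb := box_deg P
    rw [h1, h2] at hb
    have e : P = Polynomial.C (Polynomial.C ((P.coeff 0).coeff 0)) := by
      ext j i
      rcases j with _ | j
      · rcases i with _ | i
        · simp
        · rw [hb _ _ (by omega)]; simp
      · rw [hb _ _ (by omega)]; simp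
    have hne : (P.coeff 0).coeff 0 ≠ 0 := by
      intro h0; rw [h0] at e; simp at e; exact hP e
    rw [e]
    exact ((isUnit_iff_ne_zero.mpr hne).map Polynomial.C).map Polynomial.C
  constructor
  · intro hu
    have := Polynomial.natDegree_eq_zero_of_isUnit hu
    omega
  · intro P Q hPQ
    by_contra hcon
    push Not at hcon
    have hne : pol c ≠ 0 := by intro h0; rw [h0] at hny; simp at hny
    have hP : P ≠ 0 := by rintro rfl; simp [hPQ] at hne
    have hQ : Q ≠ 0 := by rintro rfl; simp [hPQ] at hne
    have dy : P.natDegree + Q.natDegree = 2 := by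
      rw [← Polynomial.natDegree_mul hP hQ, ← hPQ, hny]
    have dxx : dx P + dx Q = 2 := by rw [← dx_mul hP hQ, ← hPQ, hnx]
    have nP : 0 < dx P + P.natDegree := by
      by_contra h0
      exact hcon.1 (hunit P hP (by omega) (by omega))
    have nQ : 0 < dx Q + Q.natDegree := by
      by_contra h0
      exact hcon.2 (hunit Q hQ (by omega) (by omega))
    have zP := h.factor_lt hP (box_deg P) (by omega) (by omega) (by omega)
    have zQ := h.factor_lt hQ (box_deg Q) (by omega) (by omega) (by omega)
    have hun : zeros u v P ∪ zeros u v Q = Finset.univ := by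
      ext i
      have := hz i
      rw [hPQ, Polynomial.evalEval_mul, mul_eq_zero] at this
      simpa [mem_zeros] using this
    have hcard := Finset.card_union_le (zeros u v P) (zeros u v Q)
    rw [hun] at hcard
    simp only [Finset.card_univ, Fintype.card_fin] at hcard
    generalize dx P = p1 at *
    generalize dx Q = q1 at *
    generalize P.natDegree = p2 at *
    generalize Q.natDegree = q2 at *
    have hp1 : p1 ≤ 2 := by omega
    have hp2 : p2 ≤ 2 := by omega
    obtain rfl : q1 = 2 - p1 := by omega
    obtain rfl : q2 = 2 - p2 := by omega
    interval_cases p1 <;> interval_cases p2 <;> omega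

lemma Good.inj {u v : Fin 8 → K} (h : Good u v) : Function.Injective u := by
  intro i j hij
  by_contra hne
  have hP : Polynomial.C (Polynomial.X - Polynomial.C (u i)) ≠ (0 : Biv K) := by
    rw [Ne, Polynomial.C_eq_zero]; exact Polynomial.X_sub_C_ne_zero _
  have hb : Box (1 + 1) (0 + 1) (Polynomial.C (Polynomial.X - Polynomial.C (u i)) : Biv K) := by
    intro a b hab
    rcases b with _ | b
    · rw [Polynomial.coeff_C_zero, Polynomial.coeff_eq_zero_of_natDegree_lt]
      rw [Polynomial.natDegree_X_sub_C]; omega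
    · rw [Polynomial.coeff_C_succ, Polynomial.coeff_zero]
  have := h.factor_lt hP hb (by omega) (by omega) (by omega)
  have h2 : ({i, j} : Finset (Fin 8)) ⊆ zeros u v (Polynomial.C (Polynomial.X - Polynomial.C (u i))) := by
    intro t ht
    rw [mem_zeros, Polynomial.evalEval_C]
    simp at ht
    rcases ht with rfl | rfl
    · simp
    · simp [hij]
  have := Finset.card_le_card h2
  rw [Finset.card_pair hne] at this
  omega

theorem Good.main {u v : Fin 8 → K} (h : Good u v) {c : Fin 3 × Fin 3 → K} (hc0 : c ≠ 0)
    (hz : ∀ j, Polynomial.evalEval (u j) (v j) (pol c) = 0) (m : ℕ) : ∀ D : Biv K, D ≠ 0 →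
    (∀ i, Polynomial.X ^ m ∣ blow (u i) (v i) D) → 4 * m ≤ dx D + D.natDegree := by
  obtain ⟨hp, hy, hx⟩ := h.prime hc0 hz
  have h1 : ∀ i, Polynomial.evalEval (u i) (v i) (Polynomial.derivative (pol c)) ≠ 0 :=
    fun i hi => hc0 (h.g2 i c hz hi)
  induction m with
  | zero => intros; omega
  | succ m ih =>
    intro D hD hm
    by_cases hFD : pol c ∣ D
    · obtain ⟨E, rfl⟩ := hFD
      have hE : E ≠ 0 := by rintro rfl; simp at hD
      have hq : ∀ i, Polynomial.X ^ m ∣ blow (u i) (v i) E := by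
        intro i
        have := residual (m := m + 1) (hz i) (h1 i) (hm i)
        rwa [Nat.add_sub_cancel] at this
      have := ih E hE hq
      rw [dx_mul hp.ne_zero hE, Polynomial.natDegree_mul hp.ne_zero hE]
      omega
    · obtain ⟨U, V, r, hr, hr0, hrd⟩ := exists_elim (box_pol c) hp hy hFD
      have hdiv : ∀ i, (Polynomial.X - Polynomial.C (u i)) ^ (m + 1) ∣ r :=
        fun i => elim_dvd (hz i) (h1 i) (hm i) hr
      have hprod : ∏ i, (Polynomial.X - Polynomial.C (u i)) ^ (m + 1) ∣ r := by
        apply Fintype.prod_dvd_of_coprime _ hdiv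
        intro i j hij
        apply IsCoprime.pow
        exact Polynomial.pairwise_coprime_X_sub_C h.inj hij
      have := Polynomial.natDegree_le_of_dvd hprod hr0
      have hd : (∏ i, (Polynomial.X - Polynomial.C (u i)) ^ (m + 1)).natDegree = 8 * (m + 1) := by
        rw [Polynomial.natDegree_prod_of_monic _ _
          (fun i _ => (Polynomial.monic_X_sub_C (u i)).pow (m + 1))]
        simp only [Polynomial.natDegree_pow, Polynomial.natDegree_X_sub_C, Finset.sum_const,
          Finset.card_univ, Fintype.card_fin, smul_eq_mul, mul_one]
      omega

end Main
end Aff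

namespace Bridge
open Aff

section Generic
variable {K : Type*} [Field K]

lemma evalEval_pol (u v : K) (c : Fin 3 × Fin 3 → K) :
    Polynomial.evalEval u v (pol c) = ∑ s, u ^ (s.1 : ℕ) * v ^ (s.2 : ℕ) * c s := by
  unfold pol
  rw [Polynomial.evalEval_finsetSum]
  refine Finset.sum_congr rfl fun s _ => ?_
  simp [Polynomial.evalEval]
  ring

lemma evalEval_dpol (u v : K) (c : Fin 3 × Fin 3 → K) :
    Polynomial.evalEval u v (Polynomial.derivative (pol c)) =
      ∑ s, ((s.2 : ℕ) : K) * (u ^ (s.1 : ℕ) * v ^ ((s.2 : ℕ) - 1)) * c s := by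
  unfold pol
  rw [Polynomial.derivative_sum, Polynomial.evalEval_finsetSum]
  refine Finset.sum_congr rfl fun s _ => ?_
  simp [Polynomial.evalEval, Polynomial.derivative_monomial]
  ring

/-- Evaluation of the monomial `s` of bidegree `(2,2)` at the `i`-th point. -/
def mono (K : Type*) [Field K] (i : Fin 8) (s : Fin 3 × Fin 3) : MvPolynomial (Fin 8 × Fin 4) K :=
  X (i, 0) ^ (s.1 : ℕ) * X (i, 1) ^ (2 - (s.1 : ℕ)) * X (i, 2) ^ (s.2 : ℕ) *
    X (i, 3) ^ (2 - (s.2 : ℕ))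

/-- Its derivative with respect to the third variable. -/
def dmono (K : Type*) [Field K] (i : Fin 8) (s : Fin 3 × Fin 3) : MvPolynomial (Fin 8 × Fin 4) K :=
  C ((s.2 : ℕ) : K) * (X (i, 0) ^ (s.1 : ℕ) * X (i, 1) ^ (2 - (s.1 : ℕ)) *
    X (i, 2) ^ ((s.2 : ℕ) - 1) * X (i, 3) ^ (2 - (s.2 : ℕ)))

lemma hom_aux (i : Fin 8) (a b c d : ℕ) :
    (X (i, 0) ^ a * X (i, 1) ^ b * X (i, 2) ^ c * X (i, 3) ^ d :
      MvPolynomial (Fin 8 × Fin 4) K).IsWeightedHomogeneous (wProd 8)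
        (Pi.single i (a + b, c + d)) := by
  have h := ((((isWeightedHomogeneous_X K (wProd 8) (i, 0)).pow a).mul
    ((isWeightedHomogeneous_X K (wProd 8) (i, 1)).pow b)).mul
    ((isWeightedHomogeneous_X K (wProd 8) (i, 2)).pow c)).mul
    ((isWeightedHomogeneous_X K (wProd 8) (i, 3)).pow d)
  convert h using 1
  funext j
  by_cases hj : j = i
  · subst hj
    simp only [wProd, w4, Pi.add_apply, Pi.smul_apply, Pi.single_eq_same]
    ext <;> simp
  · simp [wProd, hj]

lemma mono_hom (i : Fin 8) (s : Fin 3 × Fin 3) :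
    (mono K i s).IsWeightedHomogeneous (wProd 8) (Pi.single i (2, 2)) := by
  have := hom_aux (K := K) i s.1 (2 - s.1) s.2 (2 - s.2)
  have h1 : (s.1 : ℕ) + (2 - s.1) = 2 := by omega
  have h2 : (s.2 : ℕ) + (2 - s.2) = 2 := by omega
  rw [h1, h2] at this
  exact this

lemma dmono_hom (i : Fin 8) (s : Fin 3 × Fin 3) :
    (dmono K i s).IsWeightedHomogeneous (wProd 8) (Pi.single i (2, 1)) := by
  unfold dmono
  by_cases h0 : (s.2 : ℕ) = 0
  · rw [h0]
    simp only [Nat.cast_zero, map_zero, zero_mul]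
    exact isWeightedHomogeneous_zero _ _ _
  · have := hom_aux (K := K) i s.1 (2 - s.1) (s.2 - 1) (2 - s.2)
    have h1 : (s.1 : ℕ) + (2 - s.1) = 2 := by omega
    have h2 : (s.2 : ℕ) - 1 + (2 - s.2) = 1 := by omega
    rw [h1, h2] at this
    exact this.C_mul _

lemma det_hom {ι : Type*} [Fintype ι] [DecidableEq ι]
    (M : Matrix ι ι (MvPolynomial (Fin 8 × Fin 4) K)) (d : ι → Fin 8 → ℕ × ℕ)
    (h : ∀ i j, (M i j).IsWeightedHomogeneous (wProd 8) (d i)) :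
    M.det.IsWeightedHomogeneous (wProd 8) (∑ i, d i) := by
  rw [← Matrix.det_transpose, Matrix.det_apply]
  apply IsWeightedHomogeneous.sum
  intro σ _
  have : (∏ i, M.transpose (σ i) i).IsWeightedHomogeneous (wProd 8) (∑ i, d i) :=
    IsWeightedHomogeneous.prod _ _ _ fun i _ => h i (σ i)
  rcases Int.units_eq_one_or (Equiv.Perm.sign σ) with hs | hs
  · rw [hs]; simpa using this
  · rw [hs]; simpa using this.neg

def matS (K : Type*) [Field K] (S : Finset (Fin 3 × Fin 3)) (e : S ↪ Fin 8) :
    Matrix S S (MvPolynomial (Fin 8 × Fin 4) K) := fun t s => mono K (e t) s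

def sig : Option (Fin 8) ≃ Fin 3 × Fin 3 := Fintype.equivOfCardEq (by simp)

def matT (K : Type*) [Field K] (i : Fin 8) :
    Matrix (Option (Fin 8)) (Option (Fin 8)) (MvPolynomial (Fin 8 × Fin 4) K) :=
  fun o s => o.elim (dmono K i (sig s)) (fun j => mono K j (sig s))

lemma eval_mono {x : Fin 8 × Fin 4 → K} {i : Fin 8} (h1 : x (i, 1) ≠ 0) (h3 : x (i, 3) ≠ 0)
    (s : Fin 3 × Fin 3) : eval x (mono K i s) = x (i, 1) ^ 2 * x (i, 3) ^ 2 *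
      ((x (i, 0) / x (i, 1)) ^ (s.1 : ℕ) * (x (i, 2) / x (i, 3)) ^ (s.2 : ℕ)) := by
  obtain ⟨a, b⟩ := s
  unfold mono
  simp only [map_mul, map_pow, eval_X]
  fin_cases a <;> fin_cases b <;> simp <;> field_simp

lemma eval_dmono {x : Fin 8 × Fin 4 → K} {i : Fin 8} (h1 : x (i, 1) ≠ 0) (h3 : x (i, 3) ≠ 0)
    (s : Fin 3 × Fin 3) : eval x (dmono K i s) = x (i, 1) ^ 2 * x (i, 3) *
      (((s.2 : ℕ) : K) * ((x (i, 0) / x (i, 1)) ^ (s.1 : ℕ) *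
        (x (i, 2) / x (i, 3)) ^ ((s.2 : ℕ) - 1))) := by
  obtain ⟨a, b⟩ := s
  unfold dmono
  simp only [map_mul, map_pow, eval_X, eval_C]
  fin_cases a <;> fin_cases b <;> simp <;> field_simp

/-- first affine coordinates -/
def uu (x : Fin 8 × Fin 4 → K) (i : Fin 8) : K := x (i, 0) / x (i, 1)
def vv (x : Fin 8 × Fin 4 → K) (i : Fin 8) : K := x (i, 2) / x (i, 3)

lemma sum_mono {x : Fin 8 × Fin 4 → K} {i : Fin 8} (h1 : x (i, 1) ≠ 0) (h3 : x (i, 3) ≠ 0)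
    (c : Fin 3 × Fin 3 → K) : ∑ s, eval x (mono K i s) * c s = x (i, 1) ^ 2 * x (i, 3) ^ 2 *
      Polynomial.evalEval (uu x i) (vv x i) (pol c) := by
  rw [evalEval_pol, Finset.mul_sum]
  refine Finset.sum_congr rfl fun s _ => ?_
  rw [eval_mono h1 h3, uu, vv]; ring

lemma sum_dmono {x : Fin 8 × Fin 4 → K} {i : Fin 8} (h1 : x (i, 1) ≠ 0) (h3 : x (i, 3) ≠ 0)
    (c : Fin 3 × Fin 3 → K) : ∑ s, eval x (dmono K i s) * c s = x (i, 1) ^ 2 * x (i, 3) *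
      Polynomial.evalEval (uu x i) (vv x i) (Polynomial.derivative (pol c)) := by
  rw [evalEval_dpol, Finset.mul_sum]
  refine Finset.sum_congr rfl fun s _ => ?_
  rw [eval_dmono h1 h3, uu, vv]; ring

lemma sub_S {x : Fin 8 × Fin 4 → K} (h1 : ∀ i, x (i, 1) ≠ 0) (h3 : ∀ i, x (i, 3) ≠ 0)
    {S : Finset (Fin 3 × Fin 3)} {e : S ↪ Fin 8} (hd : eval x (matS K S e).det ≠ 0)
    (c : Fin 3 × Fin 3 → K) (hc : ∀ s, s ∉ S → c s = 0)
    (hz : ∀ t, Polynomial.evalEval (uu x (e t)) (vv x (e t)) (pol c) = 0) : c = 0 := by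
  rw [RingHom.map_det] at hd
  have h0 : ((eval x).mapMatrix (matS K S e)).mulVec (fun s : S => c s) = 0 := by
    funext t
    have h := sum_mono (h1 (e t)) (h3 (e t)) c
    rw [hz t, mul_zero] at h
    rw [Matrix.mulVec, dotProduct, Pi.zero_apply, ← h]
    simp only [RingHom.mapMatrix_apply, Matrix.map_apply, matS]
    rw [Finset.sum_coe_sort S (fun s => eval x (mono K (e t) s) * c s)]
    apply Finset.sum_subset (Finset.subset_univ _)
    intro s _ hs
    rw [hc s hs, mul_zero]
  have h2 := Matrix.eq_zero_of_mulVec_eq_zero hd h0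
  funext s
  by_cases hs : s ∈ S
  · exact congrFun h2 ⟨s, hs⟩
  · exact hc s hs

lemma matT_mulVec {x : Fin 8 × Fin 4 → K} {i : Fin 8} (h1 : ∀ i, x (i, 1) ≠ 0)
    (h3 : ∀ i, x (i, 3) ≠ 0) (c : Fin 3 × Fin 3 → K) :
    ((eval x).mapMatrix (matT K i)).mulVec (fun s => c (sig s)) = 0 ↔
    (∀ j, Polynomial.evalEval (uu x j) (vv x j) (pol c) = 0) ∧
    Polynomial.evalEval (uu x i) (vv x i) (Polynomial.derivative (pol c)) = 0 := by
  have e1 : ∀ j, (((eval x).mapMatrix (matT K i)).mulVec (fun s => c (sig s))) (some j) =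
      x (j, 1) ^ 2 * x (j, 3) ^ 2 * Polynomial.evalEval (uu x j) (vv x j) (pol c) := by
    intro j
    rw [← sum_mono (h1 j) (h3 j) c, ← Equiv.sum_comp sig]
    rfl
  have e2 : (((eval x).mapMatrix (matT K i)).mulVec (fun s => c (sig s))) none =
      x (i, 1) ^ 2 * x (i, 3) *
        Polynomial.evalEval (uu x i) (vv x i) (Polynomial.derivative (pol c)) := by
    rw [← sum_dmono (h1 i) (h3 i) c, ← Equiv.sum_comp sig]
    rfl
  constructor
  · intro h
    rw [h] at e1 e2
    constructor
    · intro j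
      have := (e1 j).symm
      simpa [h1 j, h3 j] using this
    · have := e2.symm
      simpa [h1 i, h3 i] using this
  · rintro ⟨ha, hb⟩
    funext o
    rcases o with _ | j
    · rw [e2, hb]; simp
    · rw [e1, ha]; simp

lemma exists_det {ι Ω : Type*} [Fintype ι] [DecidableEq ι] (f : ι → Ω → K)
    (hf : ∀ c : ι → K, (∀ ω, ∑ s, c s * f s ω = 0) → c = 0) :
    ∃ q : ι → Ω, (Matrix.of fun t s => f s (q t)).det ≠ 0 := by
  let w : Ω → (ι → K) := fun ω s => f s ω
  have hspan : Submodule.span K (Set.range w) = ⊤ := by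
    by_contra hne
    obtain ⟨φ, hφ, hle⟩ := Submodule.exists_le_ker_of_lt_top _ (lt_top_iff_ne_top.mpr hne)
    apply hφ
    have hex : ∀ g : ι → K, φ g = ∑ s, φ (Pi.single s 1) * g s := by
      intro g
      conv_lhs => rw [pi_eq_sum_univ' g]
      rw [map_sum]
      refine Finset.sum_congr rfl fun s _ => ?_
      rw [map_smul, smul_eq_mul, mul_comm]
    have := hf (fun s => φ (Pi.single s 1)) (fun ω => by
      have h1 : φ (w ω) = 0 := hle (Submodule.subset_span ⟨ω, rfl⟩)
      rw [hex] at h1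
      exact h1)
    ext s
    simpa using congrFun this s
  obtain ⟨κ, a, -, hsp, hli⟩ := exists_linearIndependent' K w
  rw [hspan] at hsp
  let b := Module.Basis.mk hli hsp.ge
  let ε : ι ≃ κ := (Pi.basisFun K ι).indexEquiv b
  refine ⟨fun t => a (ε t), ?_⟩
  have hli2 : LinearIndependent K (fun t => w (a (ε t))) := hli.comp ε ε.injective
  have := Matrix.linearIndependent_rows_iff_isUnit (A := Matrix.of fun t s => f s (a (ε t)))
  have h2 := this.mp hli2
  rw [Matrix.isUnit_iff_isUnit_det] at h2
  exact h2.ne_zero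

/-- a point tuple on the curve `y = x^3` -/
def crv (r : Fin 8 → K) : Fin 8 × Fin 4 → K := fun p => ![r p.1, 1, r p.1 ^ 3, 1] p.2

lemma eval_matS_crv (S : Finset (Fin 3 × Fin 3)) (e : S ↪ Fin 8) (q : S → K) :
    eval (crv (Function.extend e q 0)) (matS K S e).det = (Matrix.of fun t s : S =>
      (q t) ^ (s.1.1 : ℕ) * ((q t) ^ 3) ^ (s.1.2 : ℕ)).det := by
  rw [RingHom.map_det]
  congr 1
  ext t s
  simp only [RingHom.mapMatrix_apply, Matrix.map_apply, matS, Matrix.of_apply]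
  rw [eval_mono (by simp [crv]) (by simp [crv])]
  simp [crv, e.injective.extend_apply]

variable [Infinite K]

lemma exists_curve_pts (S : Finset (Fin 3 × Fin 3)) :
    ∃ q : S → K, (Matrix.of fun t s : S =>
      (q t) ^ (s.1.1 : ℕ) * ((q t) ^ 3) ^ (s.1.2 : ℕ)).det ≠ 0 := by
  apply exists_det (Ω := K) (fun (s : S) t => t ^ (s.1.1 : ℕ) * (t ^ 3) ^ (s.1.2 : ℕ))
  intro c hc
  have h0 : ∑ s : S, Polynomial.C (c s) * Polynomial.X ^ ((s.1.1 : ℕ) + 3 * (s.1.2 : ℕ)) = 0 := by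
    apply Polynomial.funext
    intro t
    rw [Polynomial.eval_finsetSum]
    simp only [Polynomial.eval_mul, Polynomial.eval_C, Polynomial.eval_pow, Polynomial.eval_X,
      Polynomial.eval_zero]
    rw [← hc t]
    refine Finset.sum_congr rfl fun s _ => ?_
    rw [pow_add, pow_mul]
  funext s
  have h1 := congrArg (fun p => Polynomial.coeff p ((s.1.1 : ℕ) + 3 * (s.1.2 : ℕ))) h0
  simp only [Polynomial.finsetSum_coeff, Polynomial.coeff_C_mul, Polynomial.coeff_X_pow,
    Polynomial.coeff_zero] at h1
  rw [Finset.sum_eq_single s] at h1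
  · simpa using h1
  · intro t _ hts
    rw [if_neg, mul_zero]
    intro h
    apply hts
    apply Subtype.ext
    apply Prod.ext <;> apply Fin.ext <;> omega
  · simp

lemma matS_ne (S : Finset (Fin 3 × Fin 3)) (e : S ↪ Fin 8) : (matS K S e).det ≠ 0 := by
  intro h
  obtain ⟨q, hq⟩ := exists_curve_pts (K := K) S
  rw [← eval_matS_crv S e, h, map_zero] at hq
  exact hq rfl

lemma matT_ne (i : Fin 8) : (matT K i).det ≠ 0 := by
  intro h
  let S : Finset (Fin 3 × Fin 3) := Finset.univ.filter fun s => s ≠ (0, 0) ∧ s ≠ (0, 1)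
  have hcard : Fintype.card S = Fintype.card {j : Fin 8 // j ≠ i} := by
    rw [Fintype.card_coe, Fintype.card_subtype_compl]
    simp
    decide
  let e : S ↪ Fin 8 :=
    (Fintype.equivOfCardEq hcard).toEmbedding.trans (Function.Embedding.subtype _)
  have hei : ∀ t, e t ≠ i := fun t => (Fintype.equivOfCardEq hcard t).2
  obtain ⟨q, hq⟩ := exists_curve_pts (K := K) S
  rw [← eval_matS_crv S e] at hq
  set x := crv (Function.extend e q 0) with hx
  have hxi : uu x i = 0 ∧ vv x i = 0 := by
    have : Function.extend e q 0 i = 0 := by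
      rw [Function.extend_apply']
      · rfl
      · rintro ⟨t, ht⟩; exact hei t ht
    simp [uu, vv, hx, crv, this]
  have h1 : ∀ j, x (j, 1) ≠ 0 := by intro j; simp [hx, crv]
  have h3 : ∀ j, x (j, 3) ≠ 0 := by intro j; simp [hx, crv]
  have h' : ((eval x).mapMatrix (matT K i)).det = 0 := by rw [← RingHom.map_det, h, map_zero]
  obtain ⟨c', hc0, hc⟩ := Matrix.exists_mulVec_eq_zero_iff.mpr h'
  obtain ⟨c, rfl⟩ : ∃ c : Fin 3 × Fin 3 → K, c' = fun s => c (sig s) :=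
    ⟨fun s => c' (sig.symm s), by funext s; simp⟩
  rw [matT_mulVec h1 h3] at hc
  have c00 : c (0, 0) = 0 := by
    have := hc.1 i
    rw [evalEval_pol, hxi.1, hxi.2, Fintype.sum_prod_type] at this
    simpa [Fin.sum_univ_three] using this
  have c01 : c (0, 1) = 0 := by
    have := hc.2
    rw [evalEval_dpol, hxi.1, hxi.2, Fintype.sum_prod_type] at this
    simpa [Fin.sum_univ_three] using this
  have : c = 0 := by
    apply sub_S h1 h3 hq c
    · intro s hs
      simp only [S, Finset.mem_filter, Finset.mem_univ, true_and, not_and_or, not_not] at hs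
      rcases hs with rfl | rfl
      · exact c00
      · exact c01
    · intro t
      exact hc.1 _
  apply hc0
  rw [this]
  rfl

end Generic

section Final
variable {K : Type*} [Field K]

/-- The form defining the open set. -/
def bigG (K : Type*) [Field K] : MvPolynomial (Fin 8 × Fin 4) K :=
  (∏ i : Fin 8, (X (i, 1) * X (i, 3))) *
    (∏ S : Finset (Fin 3 × Fin 3), ∏ e : S ↪ Fin 8, (matS K S e).det) *
    ∏ i : Fin 8, (matT K i).det

lemma bigG_hom : ∃ d, (bigG K).IsWeightedHomogeneous (wProd 8) d := by
  unfold bigG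
  refine ⟨_, ((IsWeightedHomogeneous.prod _ _ _ fun i _ =>
    (isWeightedHomogeneous_X K (wProd 8) (i, 1)).mul
      (isWeightedHomogeneous_X K (wProd 8) (i, 3))).mul
    (IsWeightedHomogeneous.prod _ _ _ fun S _ => IsWeightedHomogeneous.prod _ _ _ fun e _ =>
      det_hom _ (fun t => Pi.single (e t) (2, 2)) fun t s => mono_hom _ _)).mul
    (IsWeightedHomogeneous.prod _ _ _ fun i _ =>
      det_hom _ (fun o : Option (Fin 8) => o.elim (Pi.single i (2, 1)) fun j => Pi.single j (2, 2)) ?_)⟩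
  intro o s
  rcases o with _ | j
  · exact dmono_hom _ _
  · exact mono_hom _ _

lemma bigG_ne [Infinite K] : bigG K ≠ 0 := by
  unfold bigG
  refine mul_ne_zero (mul_ne_zero ?_ ?_) ?_
  · exact Finset.prod_ne_zero_iff.mpr fun i _ => mul_ne_zero (X_ne_zero _) (X_ne_zero _)
  · exact Finset.prod_ne_zero_iff.mpr fun S _ => Finset.prod_ne_zero_iff.mpr fun e _ =>
      matS_ne S e
  · exact Finset.prod_ne_zero_iff.mpr fun i _ => matT_ne i

lemma bigG_good {x : Fin 8 × Fin 4 → K} (h : eval x (bigG K) ≠ 0) :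
    (∀ i, x (i, 1) ≠ 0) ∧ (∀ i, x (i, 3) ≠ 0) ∧ Good (uu x) (vv x) := by
  unfold bigG at h
  rw [map_mul, map_mul] at h
  have hT := right_ne_zero_of_mul h
  have hS := right_ne_zero_of_mul (left_ne_zero_of_mul h)
  have hX := left_ne_zero_of_mul (left_ne_zero_of_mul h)
  rw [map_prod, Finset.prod_ne_zero_iff] at hX hT hS
  have hX' : ∀ i, x (i, 1) ≠ 0 ∧ x (i, 3) ≠ 0 := by
    intro i
    have := hX i (Finset.mem_univ _)
    simpa using this
  have h1 := fun i => (hX' i).1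
  have h3 := fun i => (hX' i).2
  refine ⟨h1, h3, ⟨?_, ?_⟩⟩
  · intro S _ e c hc hz
    have := hS S (Finset.mem_univ _)
    rw [map_prod, Finset.prod_ne_zero_iff] at this
    exact sub_S h1 h3 (this e (Finset.mem_univ _)) c hc hz
  · intro i c hz hdz
    have hd := hT i (Finset.mem_univ _)
    rw [RingHom.map_det] at hd
    have h0 := Matrix.eq_zero_of_mulVec_eq_zero hd ((matT_mulVec h1 h3 c).mpr ⟨hz, hdz⟩)
    funext s
    have := congrFun h0 (sig.symm s)
    simpa using this

lemma exists_curve (u v : Fin 8 → K) : ∃ c : Fin 3 × Fin 3 → K, c ≠ 0 ∧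
    ∀ j, Polynomial.evalEval (u j) (v j) (pol c) = 0 := by
  let M : Matrix (Fin 8) (Fin 3 × Fin 3) K := fun j s => u j ^ (s.1 : ℕ) * v j ^ (s.2 : ℕ)
  have hk : LinearMap.ker M.mulVecLin ≠ ⊥ := by
    apply LinearMap.ker_ne_bot_of_finrank_lt
    simp
  obtain ⟨c, hc, hc0⟩ := Submodule.exists_mem_ne_zero_of_ne_bot hk
  refine ⟨c, hc0, fun j => ?_⟩
  rw [evalEval_pol]
  exact congrFun (LinearMap.mem_ker.mp hc) j

/-- dehomogenisation -/
def deh (K : Type*) [Field K] : MvPolynomial (Fin 4) K →ₐ[K] Biv K :=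
  aeval ![Polynomial.C Polynomial.X, 1, Polynomial.X, 1]

lemma deh_monomial (n : Fin 4 →₀ ℕ) (a : K) :
    deh K (monomial n a) = Polynomial.monomial (n 2) (Polynomial.monomial (n 0) a) := by
  unfold deh
  rw [aeval_monomial, Finsupp.prod_fintype _ _ (by simp)]
  simp only [Fin.prod_univ_four]
  simp [← Polynomial.C_mul_X_pow_eq_monomial, Polynomial.algebraMap_eq, mul_assoc,
    IsScalarTower.algebraMap_apply K (Polynomial K) (Biv K)]

lemma deh_coeff (D : MvPolynomial (Fin 4) K) (i j : ℕ) : ((deh K D).coeff j).coeff i =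
    ∑ n ∈ D.support, if n 2 = j ∧ n 0 = i then coeff n D else 0 := by
  conv_lhs => rw [D.as_sum]
  rw [map_sum, Polynomial.finsetSum_coeff, Polynomial.finsetSum_coeff]
  refine Finset.sum_congr rfl fun n _ => ?_
  rw [deh_monomial, Polynomial.coeff_monomial]
  by_cases h2 : n 2 = j <;> by_cases h0 : n 0 = i <;> simp [h2, h0, Polynomial.coeff_monomial]

lemma weight_w4 {D : MvPolynomial (Fin 4) K} {d : ℕ × ℕ} (hD : D.IsWeightedHomogeneous w4 d)
    {n : Fin 4 →₀ ℕ} (hn : n ∈ D.support) : n 0 + n 1 = d.1 ∧ n 2 + n 3 = d.2 := by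
  have := hD (mem_support_iff.mp hn)
  rw [Finsupp.weight_apply, Finsupp.sum_fintype _ _ (by simp), Fin.sum_univ_four] at this
  rw [← this]
  simp [w4]

lemma deh_box {D : MvPolynomial (Fin 4) K} {d : ℕ × ℕ} (hD : D.IsWeightedHomogeneous w4 d) :
    Box (d.1 + 1) (d.2 + 1) (deh K D) := by
  intro i j h
  rw [deh_coeff]
  apply Finset.sum_eq_zero
  intro n hn
  have := weight_w4 hD hn
  rw [if_neg]
  omega

lemma deh_ne {D : MvPolynomial (Fin 4) K} {d : ℕ × ℕ} (hD : D.IsWeightedHomogeneous w4 d)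
    (h0 : D ≠ 0) : deh K D ≠ 0 := by
  intro h
  obtain ⟨n, hn⟩ := support_nonempty.mpr h0
  have h1 := deh_coeff D (n 0) (n 2)
  rw [h, Finset.sum_eq_single n] at h1
  · simp at h1
    exact mem_support_iff.mp hn h1.symm
  · intro n' hn' hne
    rw [if_neg]
    rintro ⟨ha, hb⟩
    apply hne
    have a := weight_w4 hD hn
    have b := weight_w4 hD hn'
    ext t
    fin_cases t <;> simp <;> omega
  · intro hh; exact absurd hn hh

lemma blow_deh {p : (K × K) × (K × K)} (h1 : p.1.2 ≠ 0) (h3 : p.2.2 ≠ 0) {m : ℕ}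
    {D : MvPolynomial (Fin 4) K} (hD : D ∈ pointIdeal K p ^ m) :
    Polynomial.X ^ m ∣ blow (p.1.1 / p.1.2) (p.2.1 / p.2.2) (deh K D) := by
  let f : MvPolynomial (Fin 4) K →+* Biv K :=
    ((blow (p.1.1 / p.1.2) (p.2.1 / p.2.2)).comp (deh K)).toRingHom
  have hle : pointIdeal K p ≤ (Ideal.span {(Polynomial.X : Biv K)}).comap f := by
    unfold pointIdeal
    rw [Ideal.span_le]
    have hC : ∀ a b : K, b ≠ 0 → (Polynomial.C (Polynomial.C b) : Biv K) *
        Polynomial.C (Polynomial.C (a / b)) = Polynomial.C (Polynomial.C a) := by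
      intro a b hb
      rw [← map_mul, ← map_mul, mul_div_cancel₀ _ hb]
    rintro g (rfl | rfl)
    · rw [SetLike.mem_coe, Ideal.mem_comap, Ideal.mem_span_singleton]
      refine ⟨Polynomial.C (Polynomial.C p.1.2), ?_⟩
      have : f (C p.1.2 * X 0 - C p.1.1 * X 1) = Polynomial.C (Polynomial.C p.1.2) *
          (Polynomial.C (Polynomial.C (p.1.1 / p.1.2)) + Polynomial.X) -
          Polynomial.C (Polynomial.C p.1.1) := by
        simp [f, deh, blow, ← algebraMap_eq, ← Polynomial.algebraMap_eq,
          ← IsScalarTower.algebraMap_apply]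
      rw [this]
      linear_combination hC p.1.1 p.1.2 h1
    · rw [SetLike.mem_coe, Ideal.mem_comap, Ideal.mem_span_singleton]
      refine ⟨Polynomial.C (Polynomial.C p.2.2) * Polynomial.C Polynomial.X, ?_⟩
      have : f (C p.2.2 * X 2 - C p.2.1 * X 3) = Polynomial.C (Polynomial.C p.2.2) *
          (Polynomial.C (Polynomial.C (p.2.1 / p.2.2)) +
            Polynomial.C Polynomial.X * Polynomial.X) -
          Polynomial.C (Polynomial.C p.2.1) := by
        simp [f, deh, blow, ← algebraMap_eq, ← Polynomial.algebraMap_eq,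
          ← IsScalarTower.algebraMap_apply]
      rw [this]
      linear_combination hC p.2.1 p.2.2 h3
  have h2 : pointIdeal K p ^ m ≤ ((Ideal.span {(Polynomial.X : Biv K)}) ^ m).comap f :=
    (Ideal.pow_right_mono hle m).trans (Ideal.le_comap_pow f m)
  have h4 := h2 hD
  rw [Ideal.mem_comap, Ideal.span_singleton_pow, Ideal.mem_span_singleton] at h4
  exact h4

/-- the homogeneous `(2,2)` form -/
def form (c : Fin 3 × Fin 3 → K) : MvPolynomial (Fin 4) K :=
  ∑ s, C (c s) * (X 0 ^ (s.1 : ℕ) * X 1 ^ (2 - (s.1 : ℕ)) * X 2 ^ (s.2 : ℕ) *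
    X 3 ^ (2 - (s.2 : ℕ)))

lemma deh_form (c : Fin 3 × Fin 3 → K) : deh K (form c) = pol c := by
  unfold form pol deh
  rw [map_sum]
  refine Finset.sum_congr rfl fun s _ => ?_
  simp [← Polynomial.C_mul_X_pow_eq_monomial, Polynomial.algebraMap_eq, mul_assoc,
    IsScalarTower.algebraMap_apply K (Polynomial K) (Biv K)]

lemma form_hom (c : Fin 3 × Fin 3 → K) : (form c).IsWeightedHomogeneous w4 (2, 2) := by
  unfold form
  apply IsWeightedHomogeneous.sum
  intro s _
  apply IsWeightedHomogeneous.C_mul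
  have h := ((((isWeightedHomogeneous_X K w4 0).pow (s.1 : ℕ)).mul
    ((isWeightedHomogeneous_X K w4 1).pow (2 - (s.1 : ℕ)))).mul
    ((isWeightedHomogeneous_X K w4 2).pow (s.2 : ℕ))).mul
    ((isWeightedHomogeneous_X K w4 3).pow (2 - (s.2 : ℕ)))
  convert h using 1
  have h1 : (s.1 : ℕ) + (2 - s.1) = 2 := by omega
  have h2 : (s.2 : ℕ) + (2 - s.2) = 2 := by omega
  ext <;> simp [w4, h1, h2]

lemma form_mem {p : (K × K) × (K × K)} (h1 : p.1.2 ≠ 0) (h3 : p.2.2 ≠ 0)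
    (c : Fin 3 × Fin 3 → K)
    (hz : Polynomial.evalEval (p.1.1 / p.1.2) (p.2.1 / p.2.2) (pol c) = 0) :
    form c ∈ pointIdeal K p := by
  set u := p.1.1 / p.1.2 with hu
  set v := p.2.1 / p.2.2 with hv
  let π := Ideal.Quotient.mk (pointIdeal K p)
  have e0 : π (X 0) = π (C u) * π (X 1) := by
    rw [← map_mul]
    apply Ideal.Quotient.eq.mpr
    have : C p.1.2 * X 0 - C p.1.1 * X 1 ∈ pointIdeal K p := Ideal.subset_span (by simp)
    have h := Ideal.mul_mem_left _ (C p.1.2⁻¹) this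
    convert h using 1
    rw [mul_sub, ← mul_assoc, ← mul_assoc, ← C_mul, ← C_mul, inv_mul_cancel₀ h1, hu]
    simp [div_eq_inv_mul]
  have e2 : π (X 2) = π (C v) * π (X 3) := by
    rw [← map_mul]
    apply Ideal.Quotient.eq.mpr
    have : C p.2.2 * X 2 - C p.2.1 * X 3 ∈ pointIdeal K p := Ideal.subset_span (by simp)
    have h := Ideal.mul_mem_left _ (C p.2.2⁻¹) this
    convert h using 1
    rw [mul_sub, ← mul_assoc, ← mul_assoc, ← C_mul, ← C_mul, inv_mul_cancel₀ h3, hv]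
    simp [div_eq_inv_mul]
  rw [← Ideal.Quotient.eq_zero_iff_mem]
  change π (form c) = 0
  have key : π (form c) = π (C (Polynomial.evalEval u v (pol c))) * (π (X 1) ^ 2 * π (X 3) ^ 2) := by
    unfold form
    rw [evalEval_pol, map_sum, map_sum, map_sum, Finset.sum_mul]
    refine Finset.sum_congr rfl fun s _ => ?_
    simp only [map_mul, map_pow, e0, e2]
    have h1 : (s.1 : ℕ) + (2 - s.1) = 2 := by omega
    have h2 : (s.2 : ℕ) + (2 - s.2) = 2 := by omega
    have a1 : π (X 1) ^ 2 = π (X 1) ^ (s.1 : ℕ) * π (X 1) ^ (2 - (s.1 : ℕ)) := by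
      rw [← pow_add, h1]
    have a3 : π (X 3) ^ 2 = π (X 3) ^ (s.2 : ℕ) * π (X 3) ^ (2 - (s.2 : ℕ)) := by
      rw [← pow_add, h2]
    rw [a1, a3]
    ring
  rw [key, hz]
  simp

lemma alpha_eq {Z : Fin 8 → (K × K) × (K × K)} (h1 : ∀ i, (Z i).1.2 ≠ 0)
    (h3 : ∀ i, (Z i).2.2 ≠ 0)
    (hg : Good (fun i => (Z i).1.1 / (Z i).1.2) (fun i => (Z i).2.1 / (Z i).2.2)) (m : ℕ) :
    alpha K (symbolicPower K Z m) = 4 * m := by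
  obtain ⟨c, hc0, hz⟩ := exists_curve (fun i => (Z i).1.1 / (Z i).1.2)
    (fun i => (Z i).2.1 / (Z i).2.2)
  have hne : form c ≠ 0 := by
    intro h
    have := deh_form c
    rw [h, map_zero] at this
    exact hc0 (pol_eq_zero this.symm)
  have hmem : 4 * m ∈ {t | ∃ F ∈ symbolicPower K Z m, F ≠ 0 ∧ ∃ d : ℕ × ℕ, d.1 + d.2 = t ∧
      F.IsWeightedHomogeneous w4 d} := by
    refine ⟨form c ^ m, ?_, pow_ne_zero _ hne, m • (2, 2), ?_, (form_hom c).pow m⟩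
    · unfold symbolicPower
      rw [Ideal.mem_iInf]
      intro i
      exact Ideal.pow_mem_pow (form_mem (h1 i) (h3 i) c (hz i)) m
    · simp; omega
  unfold alpha
  apply le_antisymm (Nat.sInf_le hmem)
  apply le_csInf ⟨_, hmem⟩
  rintro t ⟨F, hF, hF0, d, hd, hh⟩
  unfold symbolicPower at hF
  rw [Ideal.mem_iInf] at hF
  have := hg.main hc0 hz m (deh K F) (deh_ne hh hF0)
    (fun i => blow_deh (h1 i) (h3 i) (hF i))
  have a := dx_le_of_box (deh_box hh)
  have b := natDegree_le_of_box (deh_box hh)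
  omega

end Final
end Bridge

/-- For `8` general points of `P^1 × P^1`, `γ(I) = 4`. -/
theorem gamma_general_points_8 {k : Type*} [Field k] [IsAlgClosed k] :
    GeneralPosition k 8 (fun Z =>
      Filter.Tendsto
        (fun m : ℕ => (alpha k (symbolicPower k Z m) : ℝ) / m)
        Filter.atTop (nhds (4 : ℝ))) := by
  obtain ⟨d, hd⟩ := Bridge.bigG_hom (K := k)
  refine ⟨Bridge.bigG k, d, hd, ?_, ?_⟩
  · have hx : ∃ x, eval x (Bridge.bigG k) ≠ 0 := by
      by_contra hcon
      push Not at hcon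
      exact Bridge.bigG_ne (MvPolynomial.funext fun x => by rw [hcon x, map_zero])
    obtain ⟨x, hx⟩ := hx
    obtain ⟨h1, h3, -⟩ := Bridge.bigG_good hx
    refine ⟨fun i => ((x (i, 0), x (i, 1)), (x (i, 2), x (i, 3))), ?_, ?_⟩
    · intro i
      constructor
      · intro h
        exact h1 i (congrArg Prod.snd h)
      · intro h
        exact h3 i (congrArg Prod.snd h)
    · have : coordsOf k (fun i => ((x (i, 0), x (i, 1)), (x (i, 2), x (i, 3)))) = x := by
        funext ⟨i, j⟩
        fin_cases j <;> rfl
      rw [this]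
      exact hx
  · intro Z _ _ hZ
    obtain ⟨h1, h3, hg⟩ := Bridge.bigG_good hZ
    have ha := Bridge.alpha_eq (Z := Z) h1 h3 hg
    refine tendsto_const_nhds.congr' ?_
    filter_upwards [Filter.eventually_gt_atTop 0] with m hm
    have hm' : (m : ℝ) ≠ 0 := by exact_mod_cast hm.ne'
    rw [ha]
    push_cast
    field_simp
end
end
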